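/- arXiv:1907.07511 — 11 statements merged into one kernel-verified Lean document; each statement's English description precedes it below -/
import Mathlib

section
/- The quotient ring ℚ[x,y]/⟨x⁵ − 5x³y + 6xy², 16y³ − 27x²y² + 9x⁴y⟩ is a finite-dimensional ℚ-vector space of dimension exactly 15. -/
open MvPolynomial

/-- `R₅ = x⁵ − 5x³y + 6xy²`, with `x = X 0`, `y = X 1`. -/
noncomputable def R5 : MvPolynomial (Fin 2) ℚ :=
  X 0 ^ 5 - 5 * X 0 ^ 3 * X 1 + 6 * X 0 * X 1 ^ 2

/-- `R₆ = 16y³ − 27x²y² + 9x⁴y`. -/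
noncomputable def R6 : MvPolynomial (Fin 2) ℚ :=
  16 * X 1 ^ 3 - 27 * X 0 ^ 2 * X 1 ^ 2 + 9 * X 0 ^ 4 * X 1

/-- The exponents `(a, b)` of the monomials `x ^ a * y ^ b` that form a basis of the quotient. -/
def basisExponent : Fin 15 → ℕ × ℕ :=
  ![(0, 0), (1, 0), (2, 0), (0, 1), (3, 0), (1, 1), (4, 0), (2, 1), (0, 2), (3, 1), (1, 2),
    (2, 2), (0, 3), (1, 3), (0, 4)]

section Spanning

variable {A : Type*} [CommRing A] [Algebra ℚ A]

/-- The span of the fifteen basis monomials, evaluated at two elements of a `ℚ`-algebra. -/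
def monomialSpan (x y : A) : Submodule ℚ A :=
  Submodule.span ℚ (Set.range fun i => x ^ (basisExponent i).1 * y ^ (basisExponent i).2)

theorem pow_mul_pow_mem_monomialSpan (x y : A) (i : Fin 15) :
    x ^ (basisExponent i).1 * y ^ (basisExponent i).2 ∈ monomialSpan x y :=
  Submodule.subset_span ⟨i, rfl⟩

theorem mem_of_ofNat_mul_mem {S : Submodule ℚ A} (n : ℕ) [n.AtLeastTwo] {z : A}
    (h : (ofNat(n) : A) * z ∈ S) : z ∈ S := by
  have hn : (ofNat(n) : ℚ) ≠ 0 := OfNat.ofNat_ne_zero n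
  rw [← S.smul_mem_iff hn, Algebra.smul_def, map_ofNat]
  exact h

theorem ofNat_mul_mem {S : Submodule ℚ A} (n : ℕ) [n.AtLeastTwo] {z : A}
    (h : z ∈ S) : (ofNat(n) : A) * z ∈ S := by
  rw [← map_ofNat (algebraMap ℚ A) n, ← Algebra.smul_def]
  exact S.smul_mem _ h

theorem mul_mem_monomialSpan {x y : A}
    (h5 : x ^ 5 - 5 * x ^ 3 * y + 6 * x * y ^ 2 = 0)
    (h6 : 16 * y ^ 3 - 27 * x ^ 2 * y ^ 2 + 9 * x ^ 4 * y = 0)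
    {z : A} (hz : z ∈ monomialSpan x y) :
    z * x ∈ monomialSpan x y ∧ z * y ∈ monomialSpan x y := by
  have mem := pow_mul_pow_mem_monomialSpan x y
  have r7 : 18 * (x ^ 3 * y ^ 2) = 38 * (x * y ^ 3) := by
    linear_combination x * h6 - 9 * y * h5
  have r8 : 16 * (x ^ 2 * y ^ 3) = 32 * y ^ 4 := by
    linear_combination x * r7 - 2 * y * h6
  have r9 : 32 * (x * y ^ 4) = 0 := by
    linear_combination 18 * x * r8 - 16 * y * r7
  have r10 : 64 * y ^ 5 = 0 := by
    linear_combination x * r9 - 2 * y * r8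
  have m50 : x ^ 5 ∈ monomialSpan x y := by
    have e : x ^ 5 = 5 * (x ^ 3 * y ^ 1) - 6 * (x ^ 1 * y ^ 2) := by linear_combination h5
    rw [e]
    exact sub_mem (ofNat_mul_mem 5 (mem 9)) (ofNat_mul_mem 6 (mem 10))
  have m41 : x ^ 4 * y ∈ monomialSpan x y := by
    refine mem_of_ofNat_mul_mem 9 ?_
    have e : 9 * (x ^ 4 * y) = 27 * (x ^ 2 * y ^ 2) - 16 * (x ^ 0 * y ^ 3) := by
      linear_combination h6
    rw [e]
    exact sub_mem (ofNat_mul_mem 27 (mem 11)) (ofNat_mul_mem 16 (mem 12))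
  have m32 : x ^ 3 * y ^ 2 ∈ monomialSpan x y := by
    refine mem_of_ofNat_mul_mem 18 ?_
    rw [r7]
    simpa [basisExponent] using ofNat_mul_mem 38 (mem 13)
  have m23 : x ^ 2 * y ^ 3 ∈ monomialSpan x y := by
    refine mem_of_ofNat_mul_mem 16 ?_
    rw [r8]
    simpa [basisExponent] using ofNat_mul_mem 32 (mem 14)
  have m14 : x * y ^ 4 ∈ monomialSpan x y :=
    mem_of_ofNat_mul_mem 32 (r9 ▸ zero_mem _)
  have m05 : y ^ 5 ∈ monomialSpan x y :=
    mem_of_ofNat_mul_mem 64 (r10 ▸ zero_mem _)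
  induction hz using Submodule.span_induction with
  | zero => simp
  | add u v _ _ hu hv => simpa only [add_mul] using ⟨add_mem hu.1 hv.1, add_mem hu.2 hv.2⟩
  | smul c u _ hu =>
    simpa only [smul_mul_assoc] using
      ⟨Submodule.smul_mem _ c hu.1, Submodule.smul_mem _ c hu.2⟩
  | mem u hu =>
    obtain ⟨i, rfl⟩ := hu
    have hx (a b : ℕ) : x ^ a * y ^ b * x = x ^ (a + 1) * y ^ b := by ring
    have hy (a b : ℕ) : x ^ a * y ^ b * y = x ^ a * y ^ (b + 1) := by ring
    simp only [hx, hy]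
    simp only [Fin.forall_fin_succ, basisExponent] at mem
    fin_cases i <;> simp_all [basisExponent]

end Spanning

/-- The values of the degree functional on monomials: `x ^ a * y ^ b` with `a + 2 * b = 8`
is sent to the corresponding intersection number, every other monomial to `0`. -/
def monomialDegree (a b : ℕ) : ℚ :=
  if a + 2 * b = 8 then (![182, 82, 38, 18, 9] : Fin 5 → ℚ) (Fin.ofNat 5 b) else 0

/-- The degree functional: a linear form that vanishes on the ideal of relations and induces a
perfect pairing on the quotient. -/
noncomputable def degreeForm : MvPolynomial (Fin 2) ℚ →ₗ[ℚ] ℚ :=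
  (basisMonomials (Fin 2) ℚ).constr ℚ fun s => monomialDegree (s 0) (s 1)

theorem monomial_one_eq (s : Fin 2 →₀ ℕ) :
    monomial s (1 : ℚ) = X 0 ^ s 0 * X 1 ^ s 1 := by
  simp [monomial_eq, Finsupp.prod_fintype]

theorem degreeForm_pow_mul_pow (a b : ℕ) :
    degreeForm (X 0 ^ a * X 1 ^ b) = monomialDegree a b := by
  have h := (basisMonomials (Fin 2) ℚ).constr_basis ℚ
    (fun s => monomialDegree (s 0) (s 1)) (Finsupp.single 0 a + Finsupp.single 1 b)
  simp only [coe_basisMonomials, monomial_one_eq] at h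
  simpa [degreeForm] using h

theorem degreeForm_mul_eq_zero {r : MvPolynomial (Fin 2) ℚ}
    (h : ∀ a b : ℕ, degreeForm (X 0 ^ a * X 1 ^ b * r) = 0) (p : MvPolynomial (Fin 2) ℚ) :
    degreeForm (p * r) = 0 := by
  induction p using MvPolynomial.induction_on' with
  | monomial s c =>
    have hs : monomial s c = c • monomial s (1 : ℚ) := by rw [smul_monomial, smul_eq_mul, mul_one]
    rw [hs, monomial_one_eq, smul_mul_assoc, map_smul, h, smul_zero]
  | add p q hp hq => rw [add_mul, map_add, hp, hq, add_zero]

theorem degreeForm_mul_R5 (p : MvPolynomial (Fin 2) ℚ) : degreeForm (p * R5) = 0 := by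
  refine degreeForm_mul_eq_zero (fun a b => ?_) p
  have e : (X 0 ^ a * X 1 ^ b * R5 : MvPolynomial (Fin 2) ℚ) =
      X 0 ^ (a + 5) * X 1 ^ b - (5 : ℚ) • (X 0 ^ (a + 3) * X 1 ^ (b + 1)) +
        (6 : ℚ) • (X 0 ^ (a + 1) * X 1 ^ (b + 2)) := by
    simp only [R5, smul_eq_C_mul, map_ofNat]
    ring
  simp only [e, map_add, map_sub, map_smul, degreeForm_pow_mul_pow, monomialDegree]
  by_cases hab : a + 2 * b = 3
  · have hb : b < 2 := by omega
    interval_cases b <;> obtain rfl := Nat.eq_sub_of_add_eq hab <;> norm_num [Fin.ofNat]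
  · rw [if_neg (by omega), if_neg (by omega), if_neg (by omega)]
    simp

theorem degreeForm_mul_R6 (p : MvPolynomial (Fin 2) ℚ) : degreeForm (p * R6) = 0 := by
  refine degreeForm_mul_eq_zero (fun a b => ?_) p
  have e : (X 0 ^ a * X 1 ^ b * R6 : MvPolynomial (Fin 2) ℚ) =
      (16 : ℚ) • (X 0 ^ a * X 1 ^ (b + 3)) - (27 : ℚ) • (X 0 ^ (a + 2) * X 1 ^ (b + 2)) +
        (9 : ℚ) • (X 0 ^ (a + 4) * X 1 ^ (b + 1)) := by
    simp only [R6, smul_eq_C_mul, map_ofNat]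
    ring
  simp only [e, map_add, map_sub, map_smul, degreeForm_pow_mul_pow, monomialDegree]
  by_cases hab : a + 2 * b = 2
  · have hb : b < 2 := by omega
    interval_cases b <;> obtain rfl := Nat.eq_sub_of_add_eq hab <;> norm_num [Fin.ofNat]
  · rw [if_neg (by omega), if_neg (by omega), if_neg (by omega)]
    simp

theorem degreeForm_eq_zero_of_mem {p : MvPolynomial (Fin 2) ℚ}
    (hp : p ∈ Ideal.span {R5, R6}) : degreeForm p = 0 := by
  obtain ⟨a, b, rfl⟩ := Ideal.mem_span_pair.1 hp
  rw [map_add, degreeForm_mul_R5, degreeForm_mul_R6, add_zero]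

theorem eq_zero_of_sum_mul_monomialDegree_eq_zero {g : Fin 15 → ℚ}
    (h : ∀ j, ∑ i, g i * monomialDegree ((basisExponent i).1 + (basisExponent j).1)
      ((basisExponent i).2 + (basisExponent j).2) = 0) (i : Fin 15) : g i = 0 := by
  simp [Fin.forall_fin_succ, Fin.sum_univ_succ, basisExponent, monomialDegree, Fin.ofNat] at h
  fin_cases i <;> simp <;> linarith

theorem linearIndependent_basisExponent :
    LinearIndependent ℚ fun i => Ideal.Quotient.mk (Ideal.span {R5, R6})
      (X 0 ^ (basisExponent i).1 * X 1 ^ (basisExponent i).2) := by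
  rw [Fintype.linearIndependent_iff]
  intro g hg
  refine eq_zero_of_sum_mul_monomialDegree_eq_zero fun j => ?_
  have hmem : ∑ i, g i • (X 0 ^ (basisExponent i).1 * X 1 ^ (basisExponent i).2) ∈
      Ideal.span {R5, R6} := by
    rw [← Ideal.Quotient.eq_zero_iff_mem, ← Ideal.Quotient.mkₐ_eq_mk ℚ, map_sum]
    simpa only [map_smul, Ideal.Quotient.mkₐ_eq_mk] using hg
  have hzero := degreeForm_eq_zero_of_mem
    (Ideal.mul_mem_right (X 0 ^ (basisExponent j).1 * X 1 ^ (basisExponent j).2) _ hmem)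
  simpa only [Finset.sum_mul, smul_mul_assoc, mul_mul_mul_comm, ← pow_add, map_sum, map_smul,
    degreeForm_pow_mul_pow, smul_eq_mul] using hzero

theorem map_R5 {A : Type*} [CommRing A] (φ : MvPolynomial (Fin 2) ℚ →+* A) :
    φ R5 = φ (X 0) ^ 5 - 5 * φ (X 0) ^ 3 * φ (X 1) + 6 * φ (X 0) * φ (X 1) ^ 2 := by
  simp [R5, map_ofNat φ 5, map_ofNat φ 6]

theorem map_R6 {A : Type*} [CommRing A] (φ : MvPolynomial (Fin 2) ℚ →+* A) :
    φ R6 = 16 * φ (X 1) ^ 3 - 27 * φ (X 0) ^ 2 * φ (X 1) ^ 2 + 9 * φ (X 0) ^ 4 * φ (X 1) := by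
  simp [R6, map_ofNat φ 16, map_ofNat φ 27, map_ofNat φ 9]

theorem monomialSpan_eq_top :
    monomialSpan (Ideal.Quotient.mk (Ideal.span {R5, R6}) (X 0))
      (Ideal.Quotient.mk (Ideal.span {R5, R6}) (X 1)) = ⊤ := by
  have h5 : Ideal.Quotient.mk (Ideal.span {R5, R6}) R5 = 0 :=
    Ideal.Quotient.eq_zero_iff_mem.2 (Ideal.subset_span (by simp))
  have h6 : Ideal.Quotient.mk (Ideal.span {R5, R6}) R6 = 0 :=
    Ideal.Quotient.eq_zero_iff_mem.2 (Ideal.subset_span (by simp))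
  rw [map_R5] at h5
  rw [map_R6] at h6
  refine eq_top_iff.2 fun z _ => ?_
  obtain ⟨p, rfl⟩ := Ideal.Quotient.mk_surjective z
  induction p using MvPolynomial.induction_on with
  | C c =>
    have h := Submodule.smul_mem _ c (pow_mul_pow_mem_monomialSpan
      (Ideal.Quotient.mk (Ideal.span {R5, R6}) (X 0))
      (Ideal.Quotient.mk (Ideal.span {R5, R6}) (X 1)) 0)
    have hc : Ideal.Quotient.mk (Ideal.span {R5, R6}) (C c) =
        algebraMap ℚ (MvPolynomial (Fin 2) ℚ ⧸ Ideal.span {R5, R6}) c := rfl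
    simpa [hc, basisExponent, Algebra.smul_def] using h
  | add p q hp hq => rw [map_add]; exact add_mem (hp trivial) (hq trivial)
  | mul_X p i hp =>
    have h := mul_mem_monomialSpan h5 h6 (hp trivial)
    rw [map_mul]
    fin_cases i
    exacts [h.1, h.2]

/-- The quotient ring `ℚ[x,y]/⟨R₅, R₆⟩` is a finite-dimensional `ℚ`-vector space of
dimension exactly `15`. -/
theorem stmt_0 :
    FiniteDimensional ℚ (MvPolynomial (Fin 2) ℚ ⧸ Ideal.span {R5, R6}) ∧
    Module.finrank ℚ (MvPolynomial (Fin 2) ℚ ⧸ Ideal.span {R5, R6}) = 15 := by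
  have hspan := monomialSpan_eq_top.ge
  simp only [monomialSpan, ← map_pow, ← map_mul] at hspan
  have b := Module.Basis.mk linearIndependent_basisExponent hspan
  exact ⟨b.finiteDimensional_of_finite, by simpa using Module.finrank_eq_card_basis b⟩
end

section
/- Give ℚ[x,y] the weighted grading with deg x = 1 and deg y = 2, and let I = ⟨x⁵ − 5x³y + 6xy², 16y³ − 27x²y² + 9x⁴y⟩, a weighted-homogeneous ideal. Then the ℚ-dimension of the image in ℚ[x,y]/I of the space of weighted-homogeneous polynomials of degree k equals 1, 1, 2, 2, 3, 2, 2, 1, 1 for k = 0, 1, 2, 3, 4, 5, 6, 7, 8 respectively, and equals 0 for every k ≥ 9. -/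
open MvPolynomial

/-- The ideal `I = ⟨R₅, R₆⟩`. -/
noncomputable def I12 : Ideal (MvPolynomial (Fin 2) ℚ) := Ideal.span {R5, R6}

/-- The image in `ℚ[x,y]/I` of the space of weighted-homogeneous polynomials of weighted
degree `k`, for the grading `deg x = 1`, `deg y = 2`. -/
noncomputable def gradedPiece (k : ℕ) : Submodule ℚ (MvPolynomial (Fin 2) ℚ ⧸ I12) :=
  (weightedHomogeneousSubmodule ℚ (![1, 2] : Fin 2 → ℕ) k).map
    (Ideal.Quotient.mkₐ ℚ I12).toLinearMap

local notation "ξ" => Ideal.Quotient.mk I12 (X 0)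
local notation "η" => Ideal.Quotient.mk I12 (X 1)

lemma relation_R5 : ξ ^ 5 - 5 * ξ ^ 3 * η + 6 * ξ * η ^ 2 = 0 := by
  have h : Ideal.Quotient.mk I12 R5 = 0 :=
    Ideal.Quotient.eq_zero_iff_mem.2 (Ideal.subset_span (by simp))
  simpa only [R5, map_add, map_sub, map_mul, map_pow, map_ofNat] using h

lemma relation_R6 : 16 * η ^ 3 - 27 * ξ ^ 2 * η ^ 2 + 9 * ξ ^ 4 * η = 0 := by
  have h : Ideal.Quotient.mk I12 R6 = 0 :=
    Ideal.Quotient.eq_zero_iff_mem.2 (Ideal.subset_span (by simp))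
  simpa only [R6, map_add, map_sub, map_mul, map_pow, map_ofNat] using h

lemma weight_one_two (d : Fin 2 →₀ ℕ) :
    Finsupp.weight (![1, 2] : Fin 2 → ℕ) d = d 0 + 2 * d 1 := by
  simp [Finsupp.weight_apply, Finsupp.sum_fintype, mul_comm]

lemma monomial_fin_two (d : Fin 2 →₀ ℕ) :
    (monomial d 1 : MvPolynomial (Fin 2) ℚ) = X 0 ^ d 0 * X 1 ^ d 1 := by
  rw [monomial_eq, Finsupp.prod_fintype _ _ (by simp)]
  simp

lemma X_pow_mul_X_pow_eq_monomial (a b : ℕ) :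
    (X 0 ^ a * X 1 ^ b : MvPolynomial (Fin 2) ℚ) =
      monomial (Finsupp.single 0 a + Finsupp.single 1 b) 1 := by
  rw [monomial_fin_two]
  simp

lemma mem_gradedPiece (a b : ℕ) : ξ ^ a * η ^ b ∈ gradedPiece (a + 2 * b) := by
  refine ⟨X 0 ^ a * X 1 ^ b, ?_, by simp⟩
  rw [X_pow_mul_X_pow_eq_monomial]
  refine isWeightedHomogeneous_monomial _ _ _ ?_
  rw [weight_one_two]
  simp

lemma gradedPiece_le {k : ℕ} {S : Submodule ℚ (MvPolynomial (Fin 2) ℚ ⧸ I12)}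
    (h : ∀ a b, a + 2 * b = k → ξ ^ a * η ^ b ∈ S) : gradedPiece k ≤ S := by
  rintro _ ⟨p, hp, rfl⟩
  rw [p.as_sum, map_sum]
  refine S.sum_mem fun d hd => ?_
  have hw : d 0 + 2 * d 1 = k := by
    rw [← weight_one_two]
    exact hp (mem_support_iff.1 hd)
  rw [← mul_one (coeff d p), ← smul_eq_mul, ← smul_monomial, map_smul, monomial_fin_two]
  exact S.smul_mem _ (by simpa using h _ _ hw)

/-- The first `n` monomials of weighted degree `k`, ordered by their exponent in `y`. -/
noncomputable def leadingMonomials (k n : ℕ) (i : Fin n) : MvPolynomial (Fin 2) ℚ ⧸ I12 :=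
  ξ ^ (k - 2 * (i : ℕ)) * η ^ (i : ℕ)

/-- Values of the socle functional on `x⁸, x⁶y, x⁴y², x²y³, y⁴`. -/
def socleValue : ℕ → ℚ
  | 0 => 182
  | 1 => 82
  | 2 => 38
  | 3 => 18
  | 4 => 9
  | _ => 0

/-- The linear functional on `ℚ[x,y]`, supported in weighted degree `8`, that vanishes on `I12`
and induces its Poincaré duality pairing. -/
noncomputable def socleFunctional : MvPolynomial (Fin 2) ℚ →ₗ[ℚ] ℚ :=
  (basisMonomials (Fin 2) ℚ).constr ℚ
    fun d => if d 0 + 2 * d 1 = 8 then socleValue (d 1) else 0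

lemma socleFunctional_X_pow_mul_X_pow (a b : ℕ) :
    socleFunctional (X 0 ^ a * X 1 ^ b) = if a + 2 * b = 8 then socleValue b else 0 := by
  have h := (basisMonomials (Fin 2) ℚ).constr_basis ℚ
    (fun d => if d 0 + 2 * d 1 = 8 then socleValue (d 1) else 0)
    (Finsupp.single 0 a + Finsupp.single 1 b)
  rw [coe_basisMonomials] at h
  rw [X_pow_mul_X_pow_eq_monomial, socleFunctional, h]
  simp

lemma socleFunctional_mul_eq_zero {r : MvPolynomial (Fin 2) ℚ}
    (h : ∀ a b, socleFunctional (X 0 ^ a * X 1 ^ b * r) = 0) (p : MvPolynomial (Fin 2) ℚ) :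
    socleFunctional (p * r) = 0 := by
  rw [p.as_sum, Finset.sum_mul, map_sum]
  refine Finset.sum_eq_zero fun d _ => ?_
  rw [← mul_one (coeff d p), ← smul_eq_mul (coeff d p), ← smul_monomial, smul_mul_assoc,
    map_smul, monomial_fin_two, h, smul_zero]

lemma socleFunctional_mul_R5 (a b : ℕ) : socleFunctional (X 0 ^ a * X 1 ^ b * R5) = 0 := by
  have h : (X 0 ^ a * X 1 ^ b * R5 : MvPolynomial (Fin 2) ℚ) =
      (1 : ℚ) • (X 0 ^ (a + 5) * X 1 ^ b) - (5 : ℚ) • (X 0 ^ (a + 3) * X 1 ^ (b + 1)) +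
        (6 : ℚ) • (X 0 ^ (a + 1) * X 1 ^ (b + 2)) := by
    simp only [R5, smul_eq_C_mul, map_ofNat, map_one]
    ring
  simp only [h, map_add, map_sub, map_smul, socleFunctional_X_pow_mul_X_pow]
  by_cases hab : a + 2 * b = 3
  · obtain rfl : a = 3 - 2 * b := by omega
    have hb : b ≤ 1 := by omega
    interval_cases b <;> norm_num [socleValue]
  · rw [if_neg (by omega), if_neg (by omega), if_neg (by omega)]
    simp

lemma socleFunctional_mul_R6 (a b : ℕ) : socleFunctional (X 0 ^ a * X 1 ^ b * R6) = 0 := by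
  have h : (X 0 ^ a * X 1 ^ b * R6 : MvPolynomial (Fin 2) ℚ) =
      (16 : ℚ) • (X 0 ^ a * X 1 ^ (b + 3)) - (27 : ℚ) • (X 0 ^ (a + 2) * X 1 ^ (b + 2)) +
        (9 : ℚ) • (X 0 ^ (a + 4) * X 1 ^ (b + 1)) := by
    simp only [R6, smul_eq_C_mul, map_ofNat]
    ring
  simp only [h, map_add, map_sub, map_smul, socleFunctional_X_pow_mul_X_pow]
  by_cases hab : a + 2 * b = 2
  · obtain rfl : a = 2 - 2 * b := by omega
    have hb : b ≤ 1 := by omega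
    interval_cases b <;> norm_num [socleValue]
  · rw [if_neg (by omega), if_neg (by omega), if_neg (by omega)]
    simp

lemma socleFunctional_eq_zero_of_mem {p : MvPolynomial (Fin 2) ℚ} (hp : p ∈ I12) :
    socleFunctional p = 0 := by
  obtain ⟨a, b, rfl⟩ := Ideal.mem_span_pair.1 hp
  rw [map_add, socleFunctional_mul_eq_zero socleFunctional_mul_R5,
    socleFunctional_mul_eq_zero socleFunctional_mul_R6, add_zero]

lemma det_socleValue_ne_zero {n : ℕ} (hn : n ≤ 3) :
    (Matrix.of fun i j : Fin n => socleValue (i + j)).det ≠ 0 := by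
  interval_cases n
  · simp
  · simp [socleValue]
  · norm_num [Matrix.det_fin_two, socleValue]
  · norm_num [Matrix.det_fin_three, socleValue]

lemma linearIndependent_leadingMonomials {k n : ℕ} (hn : n ≤ 3) (hk : 2 * n ≤ k + 2)
    (hk' : 2 * n + k ≤ 10) : LinearIndependent ℚ (leadingMonomials k n) := by
  rw [Fintype.linearIndependent_iff]
  intro g hg
  refine congrFun (Matrix.eq_zero_of_vecMul_eq_zero (det_socleValue_ne_zero hn) ?_)
  have hmem : ∑ i, g i • (X 0 ^ (k - 2 * (i : ℕ)) * X 1 ^ (i : ℕ) : MvPolynomial (Fin 2) ℚ)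
      ∈ I12 := by
    rw [← Ideal.Quotient.eq_zero_iff_mem, ← Ideal.Quotient.mkₐ_eq_mk ℚ, map_sum, ← hg]
    refine Finset.sum_congr rfl fun i _ => ?_
    rw [map_smul]
    simp [leadingMonomials]
  funext j
  have h := socleFunctional_eq_zero_of_mem
    (I12.mul_mem_right (X 0 ^ (8 - k - 2 * (j : ℕ)) * X 1 ^ (j : ℕ)) hmem)
  rw [Finset.sum_mul, map_sum] at h
  rw [Pi.zero_apply, ← h, Matrix.vecMul, dotProduct]
  refine Finset.sum_congr rfl fun i _ => ?_
  rw [smul_mul_assoc, mul_mul_mul_comm, ← pow_add, ← pow_add, map_smul,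
    socleFunctional_X_pow_mul_X_pow, if_pos (by omega), smul_eq_mul, Matrix.of_apply]

lemma finrank_gradedPiece {k n : ℕ} (hn : n ≤ 3) (hk : 2 * n ≤ k + 2) (hk' : 2 * n + k ≤ 10)
    (hsp : ∀ b, n ≤ b → 2 * b ≤ k → ∃ N : ℕ, N ≠ 0 ∧ ∃ g : Fin n → ℤ,
      (N : MvPolynomial (Fin 2) ℚ ⧸ I12) * (ξ ^ (k - 2 * b) * η ^ b) =
        ∑ i, g i * leadingMonomials k n i) :
    Module.finrank ℚ (gradedPiece k) = n := by
  have key : gradedPiece k = Submodule.span ℚ (Set.range (leadingMonomials k n)) := by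
    apply le_antisymm
    · refine gradedPiece_le fun a b hab => ?_
      obtain rfl : a = k - 2 * b := by omega
      rcases lt_or_ge b n with hb | hb
      · exact Submodule.subset_span ⟨⟨b, hb⟩, rfl⟩
      · obtain ⟨N, hN, g, hg⟩ := hsp b hb (by omega)
        have hN' : (N : ℚ) ≠ 0 := by exact_mod_cast hN
        rw [← Submodule.smul_mem_iff _ hN', Nat.cast_smul_eq_nsmul, nsmul_eq_mul, hg]
        refine Submodule.sum_mem _ fun i _ => ?_
        rw [← zsmul_eq_mul]
        exact zsmul_mem (Submodule.subset_span (Set.mem_range_self i)) _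
    · rw [Submodule.span_le]
      rintro _ ⟨i, rfl⟩
      have h := mem_gradedPiece (k - 2 * (i : ℕ)) i
      rwa [Nat.sub_add_cancel (by omega)] at h
  rw [key, finrank_span_eq_card (linearIndependent_leadingMonomials hn hk hk'),
    Fintype.card_fin]

lemma eq_zero_of_natCast_mul_eq_zero {N : ℕ} (hN : N ≠ 0) {v : MvPolynomial (Fin 2) ℚ ⧸ I12}
    (h : (N : MvPolynomial (Fin 2) ℚ ⧸ I12) * v = 0) : v = 0 := by
  have hN' : (N : ℚ) ≠ 0 := by exact_mod_cast hN
  rwa [← nsmul_eq_mul, ← Nat.cast_smul_eq_nsmul ℚ, smul_eq_zero_iff_right hN'] at h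

lemma pow_mul_pow_eq_zero (a b : ℕ) (h : 9 ≤ a + 2 * b) : ξ ^ a * η ^ b = 0 := by
  have h5 := relation_R5
  have h6 := relation_R6
  generalize ξ = x at *
  generalize η = y at *
  have degree_nine (b : ℕ) (hb : b ≤ 4) : x ^ (9 - 2 * b) * y ^ b = 0 := by
    apply eq_zero_of_natCast_mul_eq_zero (N := 16) (by norm_num)
    interval_cases b <;> norm_num
    · linear_combination (16 * x ^ 4 - 1801 * x ^ 2 * y + 1456 * y ^ 2) * h5 +
        (209 * x ^ 3 - 546 * x * y) * h6
    · linear_combination (-803 * x ^ 2 * y + 656 * y ^ 2) * h5 +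
        (91 * x ^ 3 - 246 * x * y) * h6
    · linear_combination (-369 * x ^ 2 * y + 304 * y ^ 2) * h5 +
        (41 * x ^ 3 - 114 * x * y) * h6
    · linear_combination (-171 * x ^ 2 * y + 144 * y ^ 2) * h5 +
        (19 * x ^ 3 - 54 * x * y) * h6
    · linear_combination (-81 * x ^ 2 * y + 72 * y ^ 2) * h5 +
        (9 * x ^ 3 - 26 * x * y) * h6
  have y_pow_five : y ^ 5 = 0 := by
    apply eq_zero_of_natCast_mul_eq_zero (N := 32) (by norm_num)
    norm_num
    linear_combination (-81 * x ^ 3 * y + 81 * x * y ^ 2) * h5 +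
      (9 * x ^ 4 - 27 * x ^ 2 * y + 2 * y ^ 2) * h6
  rcases le_or_gt 5 b with hb | hb
  · rw [pow_eq_zero_of_le hb y_pow_five, mul_zero]
  · rw [← Nat.sub_add_cancel (show 9 - 2 * b ≤ a by omega), pow_add, mul_assoc,
      degree_nine b (by omega), mul_zero]

/-- The graded dimensions of `ℚ[x,y]/⟨R₅,R₆⟩` for the weighted grading `deg x = 1`,
`deg y = 2` are `1,1,2,2,3,2,2,1,1` in degrees `0,…,8` and `0` in all degrees `≥ 9`. -/
theorem stmt_1 :
    Module.finrank ℚ (gradedPiece 0) = 1 ∧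
    Module.finrank ℚ (gradedPiece 1) = 1 ∧
    Module.finrank ℚ (gradedPiece 2) = 2 ∧
    Module.finrank ℚ (gradedPiece 3) = 2 ∧
    Module.finrank ℚ (gradedPiece 4) = 3 ∧
    Module.finrank ℚ (gradedPiece 5) = 2 ∧
    Module.finrank ℚ (gradedPiece 6) = 2 ∧
    Module.finrank ℚ (gradedPiece 7) = 1 ∧
    Module.finrank ℚ (gradedPiece 8) = 1 ∧
    ∀ k : ℕ, 9 ≤ k → Module.finrank ℚ (gradedPiece k) = 0 := by
  have h5 := relation_R5
  have h6 := relation_R6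
  refine ⟨?_, ?_, ?_, ?_, ?_, ?_, ?_, ?_, ?_, fun k hk => ?_⟩
  iterate 5
    · exact finrank_gradedPiece (by norm_num) (by norm_num) (by norm_num) (by omega)
  rotate_left 4
  · have : gradedPiece k = ⊥ := le_bot_iff.1 <| gradedPiece_le fun a b hab =>
      (Submodule.mem_bot ℚ).2 (pow_mul_pow_eq_zero a b (by omega))
    rw [this, finrank_bot]
  all_goals
    refine finrank_gradedPiece (by norm_num) (by norm_num) (by norm_num) fun b hb hb' => ?_
    simp only [leadingMonomials, Fin.sum_univ_two, Fin.sum_univ_one, Fin.val_zero, Fin.val_one]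
    generalize ξ = x at *
    generalize η = y at *
  · obtain rfl : b = 2 := by omega
    refine ⟨6, by norm_num, ![-1, 5], ?_⟩
    norm_num
    linear_combination h5
  · obtain rfl | rfl : b = 2 ∨ b = 3 := by omega
    · refine ⟨6, by norm_num, ![-1, 5], ?_⟩
      norm_num
      linear_combination x * h5
    · refine ⟨32, by norm_num, ![-9, 27], ?_⟩
      norm_num
      linear_combination 9 * x * h5 + 2 * h6
  · obtain rfl | rfl | rfl : b = 1 ∨ b = 2 ∨ b = 3 := by omega
    · refine ⟨91, by norm_num, ![41], ?_⟩
      norm_num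
      linear_combination (-41 * x ^ 2 + 48 * y) * h5 - 18 * x * h6
    · refine ⟨91, by norm_num, ![19], ?_⟩
      norm_num
      linear_combination (-19 * x ^ 2 + 40 * y) * h5 - 15 * x * h6
    · refine ⟨182, by norm_num, ![18], ?_⟩
      norm_num
      linear_combination (-18 * x ^ 2 + 81 * y) * h5 - 19 * x * h6
  · obtain rfl | rfl | rfl | rfl : b = 1 ∨ b = 2 ∨ b = 3 ∨ b = 4 := by omega
    · refine ⟨91, by norm_num, ![41], ?_⟩
      norm_num
      linear_combination (-41 * x ^ 3 + 48 * x * y) * h5 - 18 * x ^ 2 * h6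
    · refine ⟨91, by norm_num, ![19], ?_⟩
      norm_num
      linear_combination (-19 * x ^ 3 + 40 * x * y) * h5 - 15 * x ^ 2 * h6
    · refine ⟨182, by norm_num, ![18], ?_⟩
      norm_num
      linear_combination (-18 * x ^ 3 + 81 * x * y) * h5 - 19 * x ^ 2 * h6
    · refine ⟨2912, by norm_num, ![144], ?_⟩
      norm_num
      linear_combination (-144 * x ^ 3 + 1467 * x * y) * h5 + (-243 * x ^ 2 + 182 * y) * h6
end

section
/- The pair of polynomials x⁵ − 5x³y + 6xy² and 16y³ − 27x²y² + 9x⁴y is a regular sequence in the polynomial ring ℚ[x,y]; equivalently, 16y³ − 27x²y² + 9x⁴y is a nonzerodivisor in ℚ[x,y]/⟨x⁵ − 5x³y + 6xy²⟩ and the quotient by both is nonzero. -/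
open MvPolynomial

theorem isSMulRegular_quotSMulTop_self_of_isRelPrime {R : Type*} [CommRing R]
    [DecompositionMonoid R] {a b : R} (h : IsRelPrime a b) :
    IsSMulRegular (QuotSMulTop a R) b := by
  rw [isSMulRegular_quotient_iff_mem_of_smul_mem]
  intro f hf
  rw [← Submodule.ideal_span_singleton_smul, smul_eq_mul, Ideal.mul_top,
    Ideal.mem_span_singleton] at hf ⊢
  exact h.dvd_of_dvd_mul_left hf

theorem Ideal.Quotient.mk_mem_nonZeroDivisors_of_isRelPrime {R : Type*} [CommRing R]
    [DecompositionMonoid R] {a b : R} (h : IsRelPrime a b) :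
    Ideal.Quotient.mk (Ideal.span {a}) b ∈ nonZeroDivisors (R ⧸ Ideal.span {a}) := by
  rw [mem_nonZeroDivisors_iff_right]
  intro z hz
  obtain ⟨f, rfl⟩ := Ideal.Quotient.mk_surjective z
  rw [← map_mul, Ideal.Quotient.eq_zero_iff_dvd] at hz
  exact (Ideal.Quotient.eq_zero_iff_dvd _ _).2 (h.dvd_of_dvd_mul_right hz)

theorem MvPolynomial.isUnit_ofNat {σ K : Type*} [Field K] [CharZero K] (n : ℕ) [n.AtLeastTwo] :
    IsUnit (OfNat.ofNat n : MvPolynomial σ K) := by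
  rw [← map_ofNat (C : K →+* MvPolynomial σ K) n]
  exact (IsUnit.mk0 _ (OfNat.ofNat_ne_zero n)).map C

theorem R5_ne_zero : R5 ≠ 0 := by
  intro h
  have := congrArg (eval ![1, 0]) h
  simp [R5] at this

theorem isRelPrime_R5_R6 : IsRelPrime R5 R6 := by
  intro d h5 h6
  have hx : d ∣ 16 * X 0 ^ 9 := by
    have : (16 * X 0 ^ 9 : MvPolynomial (Fin 2) ℚ) =
        R5 * (16 * X 0 ^ 4 - 1801 * X 0 ^ 2 * X 1 + 1456 * X 1 ^ 2) +
          R6 * (209 * X 0 ^ 3 - 546 * X 0 * X 1) := by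
      rw [R5, R6]; ring
    exact this ▸ dvd_add (h5.mul_right _) (h6.mul_right _)
  have hy : d ∣ 32 * X 1 ^ 5 := by
    have : (32 * X 1 ^ 5 : MvPolynomial (Fin 2) ℚ) =
        R5 * (81 * X 0 * X 1 ^ 2 - 81 * X 0 ^ 3 * X 1) +
          R6 * (9 * X 0 ^ 4 - 27 * X 0 ^ 2 * X 1 + 2 * X 1 ^ 2) := by
      rw [R5, R6]; ring
    exact this ▸ dvd_add (h5.mul_right _) (h6.mul_right _)
  rw [(isUnit_ofNat _).dvd_mul_left] at hx hy
  have hxy : IsRelPrime (X 0 : MvPolynomial (Fin 2) ℚ) (X 1) :=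
    X_prime.irreducible.isRelPrime_iff_not_dvd.2 (by simp [X_dvd_X])
  exact hxy.pow hx hy

theorem span_R5_R6_ne_top : Ideal.span {R5, R6} ≠ ⊤ := by
  have hle : Ideal.span {R5, R6} ≤ RingHom.ker (constantCoeff (σ := Fin 2) (R := ℚ)) := by
    rw [Ideal.span_le]
    rintro f (rfl | rfl) <;> simp [R5, R6]
  exact fun h => RingHom.ker_ne_top _ (top_le_iff.1 (h ▸ hle))

/-- `(R₅, R₆)` is a regular sequence in `ℚ[x,y]`; equivalently, the image of `R₆` is a
nonzerodivisor in `ℚ[x,y]/⟨R₅⟩` and the quotient by both is nonzero. -/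
theorem stmt_2 :
    RingTheory.Sequence.IsRegular (MvPolynomial (Fin 2) ℚ) [R5, R6] ∧
    (Ideal.Quotient.mk (Ideal.span {R5}) R6 ∈
      nonZeroDivisors (MvPolynomial (Fin 2) ℚ ⧸ Ideal.span {R5})) ∧
    Nontrivial (MvPolynomial (Fin 2) ℚ ⧸ Ideal.span {R5, R6}) := by
  refine ⟨⟨?_, ?_⟩, Ideal.Quotient.mk_mem_nonZeroDivisors_of_isRelPrime isRelPrime_R5_R6,
    Ideal.Quotient.nontrivial_iff.2 span_R5_R6_ne_top⟩
  · rw [RingTheory.Sequence.isWeaklyRegular_cons_iff,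
      RingTheory.Sequence.isWeaklyRegular_singleton_iff]
    exact ⟨.of_ne_zero R5_ne_zero, isSMulRegular_quotSMulTop_self_of_isRelPrime isRelPrime_R5_R6⟩
  · simpa [Ideal.span_insert] using span_R5_R6_ne_top.symm
end

section
/- Let I be the ideal of ℚ[x,y,q] generated by R₅(q) = x⁵ − 5x³y + 6xy² + 4qx and R₆(q) = 16y³ − 27x²y² + 9x⁴y + 32qy − 28qx². Then the quotient ℚ[x,y,q]/I is a free module of rank 15 over the polynomial subring ℚ[q]. -/
open MvPolynomial

/-- `R₅(q) = x⁵ − 5x³y + 6xy² + 4qx`, with `x = X 0`, `y = X 1`, `q = X 2`. -/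
noncomputable def R5q : MvPolynomial (Fin 3) ℚ :=
  X 0 ^ 5 - 5 * X 0 ^ 3 * X 1 + 6 * X 0 * X 1 ^ 2 + 4 * X 2 * X 0

/-- `R₆(q) = 16y³ − 27x²y² + 9x⁴y + 32qy − 28qx²`. -/
noncomputable def R6q : MvPolynomial (Fin 3) ℚ :=
  16 * X 1 ^ 3 - 27 * X 0 ^ 2 * X 1 ^ 2 + 9 * X 0 ^ 4 * X 1 + 32 * X 2 * X 1 -
    28 * X 2 * X 0 ^ 2

/-- The quotient ring `ℚ[x,y,q]/⟨R₅(q), R₆(q)⟩`. -/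
abbrev QCG : Type := MvPolynomial (Fin 3) ℚ ⧸ Ideal.span {R5q, R6q}

/-- The `ℚ[q]`-algebra structure on the quotient, `q` acting as the class of `X 2`. -/
noncomputable instance : Algebra (Polynomial ℚ) QCG :=
  ((Polynomial.aeval
    (Ideal.Quotient.mk (Ideal.span {R5q, R6q}) (X 2)) : Polynomial ℚ →ₐ[ℚ] QCG)).toRingHom.toAlgebra

/-- The free `ℚ[q]`-module with basis `xⁱ yʲ` (`i ≤ 4`, `j ≤ 2`), the monomial `xⁱ yʲ` having
index `5 * j + i`. -/
abbrev NormalForm : Type := Fin 15 → Polynomial ℚ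

namespace NormalForm

/-- Multiplication by `x` on normal forms. -/
noncomputable def mulX : Module.End (Polynomial ℚ) NormalForm where
  toFun v :=
    let q : Polynomial ℚ := Polynomial.X
    ![0,
      v 0 - 4 * q * v 4 - 287 * q ^ 2 * v 14,
      v 1,
      v 2 + (84 / 19 : ℚ) • (q * v 9),
      v 3,
      0,
      v 5 - (64 / 19 : ℚ) • (q * v 9),
      v 6,
      v 7 + 5 * v 4 + (339 / 2 : ℚ) • (q * v 14),
      v 8,
      0,
      v 10 - 6 * v 4 - (557 / 2 : ℚ) • (q * v 14),
      v 11,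
      v 12 + (41 / 19 : ℚ) • v 9,
      v 13]
  map_add' v w := by
    ext1 i
    fin_cases i <;> simp [mul_add] <;> abel
  map_smul' c v := by
    ext1 i
    fin_cases i <;> simp <;> algebra

/-- Multiplication by `y` on normal forms. -/
noncomputable def mulY : Module.End (Polynomial ℚ) NormalForm where
  toFun v :=
    let q : Polynomial ℚ := Polynomial.X
    ![0,
      -133 * q ^ 2 * v 13,
      (7 / 4 : ℚ) • (q * v 10) - 133 * q ^ 2 * v 14,
      -(14 / 19 : ℚ) • (q * v 11),
      -(14 / 19 : ℚ) • (q * v 12),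
      v 0 - 2 * q * v 10,
      v 1 - (2 / 19 : ℚ) • (q * v 11),
      v 2 - (2 / 19 : ℚ) • (q * v 12),
      v 3 + (153 / 2 : ℚ) • (q * v 13),
      v 4 - (9 / 16 : ℚ) • v 10 + (153 / 2 : ℚ) • (q * v 14),
      v 5,
      v 6 - (255 / 2 : ℚ) • (q * v 13),
      v 7 + (27 / 16 : ℚ) • v 10 - (255 / 2 : ℚ) • (q * v 14),
      v 8 + (9 / 19 : ℚ) • v 11,
      v 9 + (9 / 19 : ℚ) • v 12]
  map_add' v w := by
    ext1 i
    fin_cases i <;> simp [mul_add] <;> abel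
  map_smul' c v := by
    ext1 i
    fin_cases i <;> simp <;> algebra

theorem mulX_mulY_comm : Commute mulX mulY := by
  refine LinearMap.ext fun v => funext fun i => ?_
  fin_cases i <;> simp [mulX, mulY] <;> algebra

/-- Reduction of a polynomial to its normal form: `xⁱ yʲ qᵏ` acts on the basis vector `1`. -/
noncomputable def reduce : MvPolynomial (Fin 3) ℚ →ₗ[ℚ] NormalForm :=
  (basisMonomials (Fin 3) ℚ).constr ℚ fun m =>
    (Polynomial.X : Polynomial ℚ) ^ m 2 • (mulX ^ m 0) ((mulY ^ m 1) (Pi.single 0 1))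

theorem reduce_monomial (m : Fin 3 →₀ ℕ) (a : ℚ) :
    reduce (monomial m a) =
      a • (Polynomial.X : Polynomial ℚ) ^ m 2 • (mulX ^ m 0) ((mulY ^ m 1) (Pi.single 0 1)) := by
  have h := (basisMonomials (Fin 3) ℚ).constr_basis ℚ (fun m =>
    (Polynomial.X : Polynomial ℚ) ^ m 2 • (mulX ^ m 0) ((mulY ^ m 1)
      (Pi.single 0 1 : NormalForm))) m
  rw [← mul_one a, ← smul_eq_mul, ← smul_monomial, map_smul, smul_eq_mul, mul_one]
  rw [coe_basisMonomials] at h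
  rw [reduce, h]

theorem reduce_one : reduce 1 = Pi.single 0 1 := by
  rw [← C_1, ← monomial_zero', reduce_monomial]
  simp

theorem reduce_X_zero_mul (p : MvPolynomial (Fin 3) ℚ) : reduce (X 0 * p) = mulX (reduce p) := by
  induction p using MvPolynomial.induction_on' with
  | add p r hp hr => simp only [mul_add, map_add, hp, hr]
  | monomial m a =>
    rw [X, monomial_mul, reduce_monomial, reduce_monomial, LinearMap.map_smul_of_tower]
    simp [pow_add]

theorem reduce_X_one_mul (p : MvPolynomial (Fin 3) ℚ) : reduce (X 1 * p) = mulY (reduce p) := by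
  induction p using MvPolynomial.induction_on' with
  | add p r hp hr => simp only [mul_add, map_add, hp, hr]
  | monomial m a =>
    rw [X, monomial_mul, reduce_monomial, reduce_monomial, LinearMap.map_smul_of_tower]
    have h : ∀ w, (mulX ^ m 0) (mulY w) = mulY ((mulX ^ m 0) w) := fun w =>
      LinearMap.congr_fun (mulX_mulY_comm.pow_left (m 0)).eq w
    simp [pow_add, h]

theorem reduce_X_two_mul (p : MvPolynomial (Fin 3) ℚ) :
    reduce (X 2 * p) = (Polynomial.X : Polynomial ℚ) • reduce p := by
  induction p using MvPolynomial.induction_on' with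
  | add p r hp hr => simp only [mul_add, map_add, smul_add, hp, hr]
  | monomial m a =>
    rw [X, monomial_mul, reduce_monomial, reduce_monomial, smul_comm Polynomial.X a]
    simp [pow_add, mul_smul]

theorem reduce_mul_eq_zero {r : MvPolynomial (Fin 3) ℚ} (hr : reduce r = 0)
    (p : MvPolynomial (Fin 3) ℚ) : reduce (p * r) = 0 := by
  induction p using MvPolynomial.induction_on with
  | C a => rw [C_mul', map_smul, hr, smul_zero]
  | add p s hp hs => rw [add_mul, map_add, hp, hs, add_zero]
  | mul_X p i hp =>
    rw [mul_comm p, mul_assoc]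
    fin_cases i
    · exact (reduce_X_zero_mul _).trans (by rw [hp, map_zero])
    · exact (reduce_X_one_mul _).trans (by rw [hp, map_zero])
    · exact (reduce_X_two_mul _).trans (by rw [hp, smul_zero])

theorem mulX_single (j : Fin 15) (hj : (j : ℕ) % 5 ≠ 4) :
    mulX (Pi.single j 1) = Pi.single (j + 1) 1 := by
  ext1 i
  fin_cases j <;> first
    | exact absurd rfl hj
    | fin_cases i <;> simp [mulX]

set_option maxHeartbeats 1000000 in
theorem mulY_single (j : Fin 15) (hj : (j : ℕ) < 10) :
    mulY (Pi.single j 1) = Pi.single (j + 5) 1 := by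
  ext1 i
  fin_cases j <;> first
    | exact absurd hj (by decide)
    | fin_cases i <;> simp [mulY]

theorem reduce_X_pow_mul_X_pow (i j : ℕ) (hi : i < 5) (hj : j < 3) :
    reduce (X 0 ^ i * X 1 ^ j) = Pi.single (Fin.ofNat 15 (5 * j + i)) 1 := by
  induction i with
  | zero =>
    induction j with
    | zero => simp [reduce_one]
    | succ j ih =>
      rw [pow_succ', mul_left_comm, reduce_X_one_mul, ih (by lia), mulY_single _ (by simp; lia)]
      congr 1
      simp [Fin.ext_iff, Fin.val_add]
      lia
  | succ i ih =>
    rw [pow_succ', mul_assoc, reduce_X_zero_mul, ih (by lia), mulX_single _ (by simp; lia)]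
    congr 1
    simp [Fin.ext_iff, Fin.val_add]
    lia

theorem reduce_R5q : reduce R5q = 0 := by
  have h : R5q = X 0 * (X 0 ^ 4 * X 1 ^ 0) - (5 : ℚ) • (X 0 ^ 3 * X 1 ^ 1) +
      (6 : ℚ) • (X 0 ^ 1 * X 1 ^ 2) + (4 : ℚ) • (X 2 * (X 0 ^ 1 * X 1 ^ 0)) := by
    rw [R5q]; algebra
  rw [h]
  simp only [map_add, map_sub, map_smul, reduce_X_zero_mul, reduce_X_two_mul]
  repeat rw [reduce_X_pow_mul_X_pow _ _ (by simp) (by simp)]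
  ext1 i
  simp only [Pi.add_apply, Pi.sub_apply, Pi.smul_apply, Pi.zero_apply]
  fin_cases i <;> simp [mulX, Fin.ofNat] <;> algebra

set_option maxHeartbeats 1000000 in
theorem reduce_R6q : reduce R6q = 0 := by
  have h : R6q = (16 : ℚ) • (X 1 * (X 0 ^ 0 * X 1 ^ 2)) - (27 : ℚ) • (X 0 ^ 2 * X 1 ^ 2) +
      (9 : ℚ) • (X 0 ^ 4 * X 1 ^ 1) + (32 : ℚ) • (X 2 * (X 0 ^ 0 * X 1 ^ 1)) -
      (28 : ℚ) • (X 2 * (X 0 ^ 2 * X 1 ^ 0)) := by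
    rw [R6q]; algebra
  rw [h]
  simp only [map_add, map_sub, map_smul, reduce_X_one_mul, reduce_X_two_mul]
  repeat rw [reduce_X_pow_mul_X_pow _ _ (by simp) (by simp)]
  ext1 i
  simp only [Pi.add_apply, Pi.sub_apply, Pi.smul_apply, Pi.zero_apply]
  fin_cases i <;> simp [mulY, Fin.ofNat] <;> algebra

theorem reduce_eq_zero_of_mem {p : MvPolynomial (Fin 3) ℚ} (hp : p ∈ Ideal.span {R5q, R6q}) :
    reduce p = 0 := by
  obtain ⟨a, b, rfl⟩ := Ideal.mem_span_pair.mp hp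
  rw [map_add, reduce_mul_eq_zero reduce_R5q, reduce_mul_eq_zero reduce_R6q, add_zero]

/-- The basis monomials `xⁱ yʲ` in a ring with elements `x` and `y`. -/
def basisMonomial {A : Type*} [CommRing A] (x y : A) : Fin 15 → A :=
  ![1, x, x ^ 2, x ^ 3, x ^ 4, y, x * y, x ^ 2 * y, x ^ 3 * y, x ^ 4 * y,
    y ^ 2, x * y ^ 2, x ^ 2 * y ^ 2, x ^ 3 * y ^ 2, x ^ 4 * y ^ 2]

section Expansion

variable {A : Type*} [CommRing A] [Algebra ℚ A] {x y q : A}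

theorem sum_mulX_eq (f : Polynomial ℚ →ₐ[ℚ] A) (hf : f Polynomial.X = q)
    (h₅ : x ^ 5 - 5 * x ^ 3 * y + 6 * x * y ^ 2 + 4 * q * x = 0)
    (h₆ : 16 * y ^ 3 - 27 * x ^ 2 * y ^ 2 + 9 * x ^ 4 * y + 32 * q * y - 28 * q * x ^ 2 = 0)
    (v : NormalForm) :
    ∑ i, f (mulX v i) * basisMonomial x y i = x * ∑ i, f (v i) * basisMonomial x y i := by
  have e₁ : x ^ 5 * y = (41 / 19 : ℚ) • (x ^ 3 * y ^ 2) + (84 / 19 : ℚ) • (q * x ^ 3) -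
      (64 / 19 : ℚ) • (q * (x * y)) := by
    linear_combination (norm := skip)
      (-(8 / 19 : ℚ) • y) * h₅ + ((3 / 19 : ℚ) • x) * h₆
    algebra
  have e₂ : x ^ 5 * y ^ 2 = (339 / 2 : ℚ) • (q * (x ^ 3 * y)) -
      (557 / 2 : ℚ) • (q * (x * y ^ 2)) - 287 * q ^ 2 * x := by
    linear_combination (norm := skip)
      (-(369 / 16 : ℚ) • (x ^ 2 * y) + 19 * y ^ 2 + (287 / 4 : ℚ) • q) * h₅ +
        ((41 / 16 : ℚ) • x ^ 3 - (57 / 8 : ℚ) • (x * y)) * h₆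
    algebra
  simp [Fin.sum_univ_succ, basisMonomial, mulX, hf, map_ofNat]
  linear_combination (norm := skip) -f (v 4) * h₅ - f (v 9) * e₁ - f (v 14) * e₂
  algebra

theorem sum_mulY_eq (f : Polynomial ℚ →ₐ[ℚ] A) (hf : f Polynomial.X = q)
    (h₅ : x ^ 5 - 5 * x ^ 3 * y + 6 * x * y ^ 2 + 4 * q * x = 0)
    (h₆ : 16 * y ^ 3 - 27 * x ^ 2 * y ^ 2 + 9 * x ^ 4 * y + 32 * q * y - 28 * q * x ^ 2 = 0)
    (v : NormalForm) :
    ∑ i, f (mulY v i) * basisMonomial x y i = y * ∑ i, f (v i) * basisMonomial x y i := by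
  have e₁ : x * y ^ 3 = (9 / 19 : ℚ) • (x ^ 3 * y ^ 2) - (14 / 19 : ℚ) • (q * x ^ 3) -
      (2 / 19 : ℚ) • (q * (x * y)) := by
    linear_combination (norm := skip)
      ((9 / 38 : ℚ) • y) * h₅ - ((1 / 38 : ℚ) • x) * h₆
    algebra
  have e₃ : x ^ 3 * y ^ 3 = (153 / 2 : ℚ) • (q * (x ^ 3 * y)) -
      (255 / 2 : ℚ) • (q * (x * y ^ 2)) - 133 * q ^ 2 * x := by
    linear_combination (norm := skip)
      (-(171 / 16 : ℚ) • (x ^ 2 * y) + 9 * y ^ 2 + (133 / 4 : ℚ) • q) * h₅ +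
        ((19 / 16 : ℚ) • x ^ 3 - (27 / 8 : ℚ) • (x * y)) * h₆
    algebra
  simp [Fin.sum_univ_succ, basisMonomial, mulY, hf, map_ofNat]
  linear_combination (norm := skip) -((1 / 16 : ℚ) • f (v 10)) * h₆ -
    (f (v 11) + f (v 12) * x) * e₁ - (f (v 13) + f (v 14) * x) * e₃
  algebra

end Expansion

theorem reduce_aeval_mul (c : Polynomial ℚ) (p : MvPolynomial (Fin 3) ℚ) :
    reduce (Polynomial.aeval (X 2) c * p) = c • reduce p := by
  induction c using Polynomial.induction_on' with
  | add c d hc hd => rw [map_add, add_mul, map_add, hc, hd, add_smul]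
  | monomial n a =>
    have h : ∀ n : ℕ, reduce (X 2 ^ n * p) = (Polynomial.X : Polynomial ℚ) ^ n • reduce p := by
      intro n
      induction n with
      | zero => simp
      | succ n ih => rw [pow_succ', mul_assoc, reduce_X_two_mul, ih, pow_succ', mul_smul]
    rw [Polynomial.aeval_monomial, ← Algebra.smul_def, smul_mul_assoc, map_smul, h,
      ← Polynomial.smul_X_eq_monomial, smul_assoc]

theorem reduce_basisMonomial (i : Fin 15) :
    reduce (basisMonomial (X 0) (X 1) i) = Pi.single i 1 := by
  have h : basisMonomial (X 0 : MvPolynomial (Fin 3) ℚ) (X 1) i =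
      X 0 ^ ((i : ℕ) % 5) * X 1 ^ ((i : ℕ) / 5) := by
    fin_cases i <;> simp [basisMonomial]
  rw [h, reduce_X_pow_mul_X_pow _ _ (by lia) (by lia), Nat.div_add_mod]
  simp

/-- The `ℚ[q]`-linear map sending a normal form to the class it represents. -/
noncomputable def toQuotient : NormalForm →ₗ[Polynomial ℚ] QCG :=
  Fintype.linearCombination (Polynomial ℚ)
    (basisMonomial (Ideal.Quotient.mk _ (X 0)) (Ideal.Quotient.mk _ (X 1)))

theorem toQuotient_apply (v : NormalForm) :
    toQuotient v = ∑ i, Polynomial.aeval (Ideal.Quotient.mk (Ideal.span {R5q, R6q}) (X 2)) (v i) *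
      basisMonomial (Ideal.Quotient.mk _ (X 0)) (Ideal.Quotient.mk _ (X 1)) i := by
  simp only [toQuotient, Fintype.linearCombination_apply, Algebra.smul_def]
  rfl

theorem map_R5q {A : Type*} [CommRing A] (f : MvPolynomial (Fin 3) ℚ →+* A) :
    f R5q = f (X 0) ^ 5 - 5 * f (X 0) ^ 3 * f (X 1) + 6 * f (X 0) * f (X 1) ^ 2 +
      4 * f (X 2) * f (X 0) := by
  simp [R5q, map_ofNat]

theorem map_R6q {A : Type*} [CommRing A] (f : MvPolynomial (Fin 3) ℚ →+* A) :
    f R6q = 16 * f (X 1) ^ 3 - 27 * f (X 0) ^ 2 * f (X 1) ^ 2 + 9 * f (X 0) ^ 4 * f (X 1) +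
      32 * f (X 2) * f (X 1) - 28 * f (X 2) * f (X 0) ^ 2 := by
  simp [R6q, map_ofNat]

theorem mk_R5q : (Ideal.Quotient.mk (Ideal.span {R5q, R6q}) R5q) = 0 :=
  Ideal.Quotient.eq_zero_iff_mem.mpr (Ideal.subset_span (by simp))

theorem mk_R6q : (Ideal.Quotient.mk (Ideal.span {R5q, R6q}) R6q) = 0 :=
  Ideal.Quotient.eq_zero_iff_mem.mpr (Ideal.subset_span (by simp))

theorem toQuotient_mulX (v : NormalForm) :
    toQuotient (mulX v) = Ideal.Quotient.mk _ (X 0) * toQuotient v := by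
  simp only [toQuotient_apply]
  exact sum_mulX_eq _ (Polynomial.aeval_X _) ((map_R5q _).symm.trans mk_R5q)
    ((map_R6q _).symm.trans mk_R6q) v

theorem toQuotient_mulY (v : NormalForm) :
    toQuotient (mulY v) = Ideal.Quotient.mk _ (X 1) * toQuotient v := by
  simp only [toQuotient_apply]
  exact sum_mulY_eq _ (Polynomial.aeval_X _) ((map_R5q _).symm.trans mk_R5q)
    ((map_R6q _).symm.trans mk_R6q) v

theorem toQuotient_X_smul (v : NormalForm) :
    toQuotient ((Polynomial.X : Polynomial ℚ) • v) = Ideal.Quotient.mk _ (X 2) * toQuotient v := by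
  rw [map_smul, Algebra.smul_def]
  exact congrArg (· * toQuotient v) (Polynomial.aeval_X _)

theorem toQuotient_reduce (p : MvPolynomial (Fin 3) ℚ) :
    toQuotient (reduce p) = Ideal.Quotient.mk _ p := by
  induction p using MvPolynomial.induction_on with
  | C a =>
    rw [← mul_one (C a), C_mul', map_smul, reduce_one, toQuotient_apply,
      Finset.sum_eq_single_of_mem 0 (Finset.mem_univ _) (fun i _ hi => by simp [hi])]
    simp [basisMonomial, Algebra.smul_def]
    rfl
  | add p r hp hr => simp only [map_add, hp, hr]
  | mul_X p i hp =>
    rw [mul_comm p, map_mul (Ideal.Quotient.mk _), ← hp]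
    fin_cases i
    · exact (congrArg _ (reduce_X_zero_mul p)).trans (toQuotient_mulX _)
    · exact (congrArg _ (reduce_X_one_mul p)).trans (toQuotient_mulY _)
    · exact (congrArg _ (reduce_X_two_mul p)).trans (toQuotient_X_smul _)

theorem toQuotient_surjective : Function.Surjective toQuotient := fun z =>
  let ⟨p, hp⟩ := Ideal.Quotient.mk_surjective z
  ⟨reduce p, (toQuotient_reduce p).trans hp⟩

theorem toQuotient_injective : Function.Injective toQuotient := by
  refine (injective_iff_map_eq_zero _).mpr fun v hv => ?_
  let p : MvPolynomial (Fin 3) ℚ :=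
    ∑ i, Polynomial.aeval (X 2) (v i) * basisMonomial (X 0) (X 1) i
  have hp : reduce p = v := by
    simp only [p, map_sum, reduce_aeval_mul, reduce_basisMonomial]
    exact (pi_eq_sum_univ' v).symm
  have hmk : Ideal.Quotient.mk (Ideal.span {R5q, R6q}) p = 0 := by
    rw [← toQuotient_reduce, hp, hv]
  rw [← hp, reduce_eq_zero_of_mem (Ideal.Quotient.eq_zero_iff_mem.mp hmk)]

/-- The quotient is free over `ℚ[q]` on the classes of the basis monomials. -/
noncomputable def equivQuotient : NormalForm ≃ₗ[Polynomial ℚ] QCG :=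
  LinearEquiv.ofBijective toQuotient ⟨toQuotient_injective, toQuotient_surjective⟩

end NormalForm

/-- `ℚ[x,y,q]/⟨R₅(q), R₆(q)⟩` is a free module of rank `15` over the polynomial
subring `ℚ[q]`. -/
theorem stmt_3 :
    Module.Free (Polynomial ℚ) QCG ∧ Module.rank (Polynomial ℚ) QCG = 15 := by
  refine ⟨Module.Free.of_equiv NormalForm.equivQuotient, ?_⟩
  rw [← NormalForm.equivQuotient.rank_eq, rank_fin_fun]
  rfl
end

section
/- For every nonzero complex number c, the ring ℂ[x,y]/⟨x⁵ − 5x³y + 6xy² + 4cx, 16y³ − 27x²y² + 9x⁴y + 32cy − 28cx²⟩ is reduced (has no nonzero nilpotent elements). -/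
open MvPolynomial

/-- An algebra is formally unramified as soon as the universal derivation kills a set of
generators. -/
theorem formallyUnramified_of_adjoin_eq_top {R A : Type*} [CommRing R] [CommRing A] [Algebra R A]
    {s : Set A} (hs : Algebra.adjoin R s = ⊤) (h : ∀ a ∈ s, KaehlerDifferential.D R A a = 0) :
    Algebra.FormallyUnramified R A := by
  have hD (a : A) : KaehlerDifferential.D R A a = 0 :=
    Derivation.eqOn_adjoin (D1 := KaehlerDifferential.D R A) (D2 := 0) h
      (hs ▸ Algebra.mem_top : a ∈ Algebra.adjoin R s)
  refine ⟨subsingleton_of_forall_eq 0 fun w => ?_⟩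
  have hw : w ∈ Submodule.span A (Set.range (KaehlerDifferential.D R A)) := by
    rw [KaehlerDifferential.span_range_derivation]
    trivial
  rwa [Submodule.span_eq_bot.2 (Set.forall_mem_range.2 hD), Submodule.mem_bot] at hw

/-- Every nonunit of a commutative ring is killed by a homomorphism to a field. -/
theorem exists_ringHom_field_eq_zero.{u} {A : Type u} [CommRing A] {a : A} (ha : ¬IsUnit a) :
    ∃ (K : Type u) (_ : Field K) (f : A →+* K), f a = 0 := by
  obtain ⟨m, hm, ham⟩ := exists_max_ideal_of_mem_nonunits ha
  exact ⟨A ⧸ m, Ideal.Quotient.field m, Ideal.Quotient.mk m, Ideal.Quotient.eq_zero_iff_mem.2 ham⟩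

/-- The Jacobian determinant of the two relations vanishes at no common zero in a field of
characteristic zero. -/
theorem jacobian_ne_zero {K : Type*} [Field K] [CharZero K] {c x y : K} (hc : c ≠ 0)
    (h₁ : x ^ 5 - 5 * x ^ 3 * y + 6 * x * y ^ 2 + 4 * c * x = 0)
    (h₂ : 16 * y ^ 3 - 27 * x ^ 2 * y ^ 2 + 9 * x ^ 4 * y + 32 * c * y - 28 * c * x ^ 2 = 0) :
    (5 * x ^ 4 - 15 * x ^ 2 * y + 6 * y ^ 2 + 4 * c) *
        (48 * y ^ 2 - 54 * x ^ 2 * y + 9 * x ^ 4 + 32 * c) -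
      (-5 * x ^ 3 + 12 * x * y) * (-54 * x * y ^ 2 + 36 * x ^ 3 * y - 56 * c * x) ≠ 0 := by
  intro hJ
  by_cases hx : x = 0
  · subst hx
    by_cases hy : y = 0
    · subst hy
      have : 128 * c ^ 2 = 0 := by linear_combination hJ
      simp_all
    · have hy₂ : y ^ 2 + 2 * c = 0 :=
        mul_left_cancel₀ (mul_ne_zero (by norm_num : (16 : K) ≠ 0) hy)
          (by linear_combination h₂)
      have : 512 * c ^ 2 = 0 := by
        linear_combination hJ - (288 * y ^ 2 - 192 * c) * hy₂
      simp_all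
  · have hq : x ^ 4 - 5 * x ^ 2 * y + 6 * y ^ 2 + 4 * c = 0 :=
      mul_left_cancel₀ hx (by linear_combination h₁)
    have hg : 7 * x ^ 6 - 34 * x ^ 4 * y + 55 * x ^ 2 * y ^ 2 - 32 * y ^ 3 = 0 := by
      linear_combination h₂ - (8 * y - 7 * x ^ 2) * hq
    have hj : 37 * x ^ 6 - 202 * x ^ 4 * y + 349 * x ^ 2 * y ^ 2 - 180 * y ^ 3 = 0 := by
      have hc' : c = -(x ^ 4 - 5 * x ^ 2 * y + 6 * y ^ 2) / 4 := by linear_combination hq / 4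
      rw [hc'] at hJ
      refine mul_left_cancel₀ (mul_ne_zero (by norm_num : (2 : K) ≠ 0) (pow_ne_zero 2 hx)) ?_
      linear_combination hJ
    have hy : 29696 * y ^ 5 = 0 := by
      linear_combination
        (-50428 * y ^ 2 + 66795 * x ^ 2 * y - 21201 * x ^ 4) * hg +
          (8800 * y ^ 2 - 10221 * x ^ 2 * y + 4011 * x ^ 4) * hj
    have hy₀ : y = 0 := by simpa using hy
    subst hy₀
    exact hx (by simpa using hg)

/-- A quotient ring generated by a common zero of the two relations is formally unramified. -/
theorem formallyUnramified_of_relations {k A : Type*} [Field k] [CharZero k] [CommRing A]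
    [Algebra k A] {c : k} (hc : c ≠ 0) {x y : A} (hxy : Algebra.adjoin k {x, y} = ⊤)
    (h₁ : x ^ 5 - 5 * x ^ 3 * y + 6 * x * y ^ 2 + 4 * algebraMap k A c * x = 0)
    (h₂ : 16 * y ^ 3 - 27 * x ^ 2 * y ^ 2 + 9 * x ^ 4 * y + 32 * algebraMap k A c * y -
      28 * algebraMap k A c * x ^ 2 = 0) :
    Algebra.FormallyUnramified k A := by
  set d := algebraMap k A c
  have hJ : IsUnit ((5 * x ^ 4 - 15 * x ^ 2 * y + 6 * y ^ 2 + 4 * d) *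
        (48 * y ^ 2 - 54 * x ^ 2 * y + 9 * x ^ 4 + 32 * d) -
      (-5 * x ^ 3 + 12 * x * y) * (-54 * x * y ^ 2 + 36 * x ^ 3 * y - 56 * d * x)) := by
    by_contra hJ
    obtain ⟨K, _, f, hf⟩ := exists_ringHom_field_eq_zero hJ
    have : CharZero K :=
      charZero_of_injective_ringHom (f.comp (algebraMap k A)).injective
    have hfd : f d ≠ 0 := (map_ne_zero (f.comp (algebraMap k A))).2 hc
    refine jacobian_ne_zero (x := f x) (y := f y) hfd ?_ ?_ ?_
    · simpa [_root_.map_ofNat] using congrArg f h₁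
    · simpa [_root_.map_ofNat] using congrArg f h₂
    · simpa [_root_.map_ofNat] using hf
  let D := KaehlerDifferential.D k A
  have hDd : D d = 0 := D.map_algebraMap c
  have hn (n : ℕ) [n.AtLeastTwo] : D (OfNat.ofNat n : A) = 0 := D.map_natCast n
  have e₁ : (5 * x ^ 4 - 15 * x ^ 2 * y + 6 * y ^ 2 + 4 * d) • D x +
      (-5 * x ^ 3 + 12 * x * y) • D y = 0 := by
    have := congrArg D h₁
    simp only [map_add, map_sub, map_zero, Derivation.leibniz, Derivation.leibniz_pow, hDd,
      hn] at this
    rw [← this]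
    module
  have e₂ : (-54 * x * y ^ 2 + 36 * x ^ 3 * y - 56 * d * x) • D x +
      (48 * y ^ 2 - 54 * x ^ 2 * y + 9 * x ^ 4 + 32 * d) • D y = 0 := by
    have := congrArg D h₂
    simp only [map_add, map_sub, map_zero, Derivation.leibniz, Derivation.leibniz_pow, hDd,
      hn] at this
    rw [← this]
    module
  refine formallyUnramified_of_adjoin_eq_top hxy ?_
  rintro a (rfl | rfl)
  · refine hJ.smul_eq_zero.1 ?_
    linear_combination (norm := module)
      (48 * y ^ 2 - 54 * a ^ 2 * y + 9 * a ^ 4 + 32 * d) • e₁ -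
        (-5 * a ^ 3 + 12 * a * y) • e₂
  · refine hJ.smul_eq_zero.1 ?_
    linear_combination (norm := module)
      (5 * x ^ 4 - 15 * x ^ 2 * a + 6 * a ^ 2 + 4 * d) • e₂ -
        (-54 * x * a ^ 2 + 36 * x ^ 3 * a - 56 * d * x) • e₁

/-- A quotient of a polynomial ring in two variables is generated by the classes of the
variables. -/
theorem adjoin_mk_X_eq_top {R : Type*} [CommRing R] (I : Ideal (MvPolynomial (Fin 2) R)) :
    Algebra.adjoin R {Ideal.Quotient.mk I (X 0), Ideal.Quotient.mk I (X 1)} = ⊤ := by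
  have h := congrArg (Subalgebra.map (Ideal.Quotient.mkₐ R I))
    (adjoin_range_X (R := R) (σ := Fin 2))
  rw [AlgHom.map_adjoin, Algebra.map_top,
    (AlgHom.range_eq_top _).2 (Ideal.Quotient.mkₐ_surjective R I)] at h
  rw [← h]
  congr 1
  ext a
  simp [Fin.exists_fin_two, eq_comm]

/-- For every nonzero complex number `c`, the ring
`ℂ[x,y]/⟨x⁵ − 5x³y + 6xy² + 4cx, 16y³ − 27x²y² + 9x⁴y + 32cy − 28cx²⟩` is reduced. -/
theorem stmt_4 (c : ℂ) (hc : c ≠ 0) :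
    IsReduced (MvPolynomial (Fin 2) ℂ ⧸ Ideal.span
      ({X 0 ^ 5 - 5 * X 0 ^ 3 * X 1 + 6 * X 0 * X 1 ^ 2 + 4 * C c * X 0,
        16 * X 1 ^ 3 - 27 * X 0 ^ 2 * X 1 ^ 2 + 9 * X 0 ^ 4 * X 1 + 32 * C c * X 1 -
          28 * C c * X 0 ^ 2} : Set (MvPolynomial (Fin 2) ℂ))) := by
  set I := Ideal.span (_ : Set (MvPolynomial (Fin 2) ℂ))
  have : Algebra.FormallyUnramified ℂ (MvPolynomial (Fin 2) ℂ ⧸ I) := by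
    refine formallyUnramified_of_relations hc (adjoin_mk_X_eq_top I) ?_ ?_
    · exact Ideal.Quotient.eq_zero_iff_mem.2 (Ideal.subset_span (Set.mem_insert _ _))
    · exact Ideal.Quotient.eq_zero_iff_mem.2
        (Ideal.subset_span (Set.mem_insert_of_mem _ (Set.mem_singleton _)))
  exact Algebra.FormallyUnramified.isReduced_of_field ℂ _
end

section
/- The ring A₁ = ℚ[x,y]/⟨x⁵ − 5x³y + 6xy² + 4x, 16y³ − 27x²y² + 9x⁴y + 32y − 28x²⟩ is a finite-dimensional ℚ-algebra of dimension 15 which is a semisimple ring. -/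
open MvPolynomial

/-- `R₅(1) = x⁵ − 5x³y + 6xy² + 4x`, with `x = X 0`, `y = X 1`. -/
noncomputable def R51 : MvPolynomial (Fin 2) ℚ :=
  X 0 ^ 5 - 5 * X 0 ^ 3 * X 1 + 6 * X 0 * X 1 ^ 2 + 4 * X 0

/-- `R₆(1) = 16y³ − 27x²y² + 9x⁴y + 32y − 28x²`. -/
noncomputable def R61 : MvPolynomial (Fin 2) ℚ :=
  16 * X 1 ^ 3 - 27 * X 0 ^ 2 * X 1 ^ 2 + 9 * X 0 ^ 4 * X 1 + 32 * X 1 - 28 * X 0 ^ 2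

namespace AdjoinRoot

variable {K : Type*} [Field K]

theorem finrank_eq_natDegree {f : Polynomial K} (hf : f ≠ 0) :
    Module.finrank K (AdjoinRoot f) = f.natDegree := by
  rw [(AdjoinRoot.powerBasis hf).finrank, AdjoinRoot.powerBasis_dim]

theorem isReduced_of_squarefree {f : Polynomial K} (hf : Squarefree f) :
    IsReduced (AdjoinRoot f) :=
  (Ideal.isRadical_iff_quotient_reduced _).1 (isRadical_iff_span_singleton.1 hf.isRadical)

theorem isSemisimpleRing_of_separable {f : Polynomial K} (hf : f.Separable) :
    IsSemisimpleRing (AdjoinRoot f) := by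
  have := isReduced_of_squarefree hf.squarefree
  have : Module.Finite K (AdjoinRoot f) := (AdjoinRoot.powerBasis hf.ne_zero).finite
  have : IsArtinianRing (AdjoinRoot f) := IsArtinianRing.of_finite K _
  exact IsArtinianRing.isSemisimpleRing_of_isReduced _

end AdjoinRoot

namespace MvPolynomial

variable {σ K : Type*} [Field K]

/-- If, modulo `J`, each variable `X i` is the value at `z` of a polynomial `p i`, and `f`
generates the relations satisfied by `z`, then the quotient by `J` is `K[T]/(f)`. -/
noncomputable def quotientEquivAdjoinRoot (J : Ideal (MvPolynomial σ K)) (f : Polynomial K)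
    (p : σ → Polynomial K) (z : MvPolynomial σ K) (hJ : ∀ g ∈ J, f ∣ aeval p g)
    (hz : Polynomial.aeval z f ∈ J) (hpz : f ∣ aeval p z - Polynomial.X)
    (hX : ∀ i, X i - Polynomial.aeval z (p i) ∈ J) :
    (MvPolynomial σ K ⧸ J) ≃ₐ[K] AdjoinRoot f :=
  AlgEquiv.ofAlgHom
    (Ideal.Quotient.liftₐ J ((AdjoinRoot.mkₐ f).comp (aeval p)) fun g hg ↦
      AdjoinRoot.mk_eq_zero.2 (hJ g hg))
    (AdjoinRoot.liftAlgHom f (Algebra.ofId K _) (Ideal.Quotient.mkₐ K J z) (by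
      change Polynomial.aeval (Ideal.Quotient.mkₐ K J z) f = 0
      rw [Polynomial.aeval_algHom_apply]
      exact Ideal.Quotient.eq_zero_iff_mem.2 hz))
    (by
      ext
      simp only [AlgHom.comp_apply, AdjoinRoot.liftAlgHom_root, AlgHom.id_apply]
      change AdjoinRoot.mk f (aeval p z) = AdjoinRoot.mk f Polynomial.X
      exact AdjoinRoot.mk_eq_mk.2 hpz)
    (by
      refine Ideal.Quotient.algHom_ext _ (MvPolynomial.algHom_ext fun i ↦ ?_)
      simp only [AlgHom.comp_apply, AlgHom.id_apply]
      change AdjoinRoot.liftAlgHom f _ _ _ (AdjoinRoot.mk f (aeval p (X i))) = _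
      rw [aeval_X, AdjoinRoot.liftAlgHom_mk]
      change Polynomial.aeval (Ideal.Quotient.mkₐ K J z) (p i) = _
      rw [Polynomial.aeval_algHom_apply]
      exact (Ideal.Quotient.eq.2 (hX i)).symm)

end MvPolynomial

theorem Ideal.span_mul_pair_eq_inf {R : Type*} [CommRing R] {a b c : R}
    (h : IsCoprime (Ideal.span {a, c}) (Ideal.span {b, c})) :
    Ideal.span {a * b, c} = Ideal.span {a, c} ⊓ Ideal.span {b, c} := by
  apply le_antisymm
  · rw [Ideal.span_le, Set.insert_subset_iff, Set.singleton_subset_iff]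
    have mem (u : R) : u ∈ Ideal.span {u, c} := Ideal.subset_span (by simp)
    have mem' (u : R) : c ∈ Ideal.span {u, c} := Ideal.subset_span (by simp)
    exact ⟨⟨Ideal.mul_mem_right _ _ (mem a), Ideal.mul_mem_left _ _ (mem b)⟩, mem' a, mem' b⟩
  · rw [← Ideal.mul_eq_inf_of_coprime (Ideal.isCoprime_iff_sup_eq.1 h),
      Ideal.span_pair_mul_span_pair, Ideal.span_le]
    rintro u (rfl | rfl | rfl | rfl)
    · exact Ideal.subset_span (by simp)
    · exact Ideal.mul_mem_left _ _ (Ideal.subset_span (by simp))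
    · exact Ideal.mul_mem_right _ _ (Ideal.subset_span (by simp))
    · exact Ideal.mul_mem_left _ _ (Ideal.subset_span (by simp))

theorem Ideal.forall_mem_span_pair_dvd {A R S : Type*} [CommRing A] [CommRing R] [CommRing S]
    [Algebra A R] [Algebra A S] {φ : R →ₐ[A] S} {a b : R} {f : S} (ha : f ∣ φ a) (hb : f ∣ φ b) :
    ∀ g ∈ Ideal.span {a, b}, f ∣ φ g := by
  intro g hg
  obtain ⟨u, v, rfl⟩ := Ideal.mem_span_pair.1 hg
  rw [map_add, map_mul, map_mul]
  exact dvd_add (ha.mul_left _) (hb.mul_left _)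

/-- The cofactor of `x` in `R₅(1)`. -/
noncomputable def quarticFactor : MvPolynomial (Fin 2) ℚ :=
  X 0 ^ 4 - 5 * X 0 ^ 2 * X 1 + 6 * X 1 ^ 2 + 4

theorem R51_eq : R51 = X 0 * quarticFactor := by
  rw [R51, quarticFactor]
  ring

/-- The equation satisfied by `y` on the component `x = 0`. -/
noncomputable def cubicEliminant : Polynomial ℚ :=
  Polynomial.X ^ 3 + 2 * Polynomial.X

/-- The equation satisfied by `x` on the component `x ≠ 0`. -/
noncomputable def duodecicEliminant : Polynomial ℚ :=
  Polynomial.X ^ 12 - 102 * Polynomial.X ^ 8 + 317 * Polynomial.X ^ 4 - 2048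

/-- The expression of `y` in terms of `x` on the component `x ≠ 0`. -/
noncomputable def yOfX : Polynomial ℚ :=
  (1 / 121568 : ℚ) •
    (63473 * Polynomial.X ^ 2 + 8898 * Polynomial.X ^ 6 - 91 * Polynomial.X ^ 10)

theorem natDegree_cubicEliminant : cubicEliminant.natDegree = 3 := by
  rw [cubicEliminant]
  compute_degree!

theorem natDegree_duodecicEliminant : duodecicEliminant.natDegree = 12 := by
  rw [duodecicEliminant]
  compute_degree!

theorem separable_cubicEliminant : cubicEliminant.Separable := by
  refine ⟨(-9 / 8 : ℚ) • Polynomial.X, (3 / 8 : ℚ) • Polynomial.X ^ 2 + (1 / 2 : ℚ) • 1, ?_⟩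
  simp only [cubicEliminant, Polynomial.derivative_add, Polynomial.derivative_mul,
    Polynomial.derivative_X_pow, Polynomial.derivative_X, Polynomial.derivative_ofNat,
    map_natCast]
  push_cast
  algebra

theorem separable_duodecicEliminant : duodecicEliminant.Separable := by
  refine ⟨(1 / 857169160192 : ℚ) •
      (-418539629 - 37655796 * Polynomial.X ^ 4 + 660525 * Polynomial.X ^ 8),
    (1 / 3428676640768 : ℚ) • (Polynomial.X *
      (175261805 + 20037882 * Polynomial.X ^ 4 - 220175 * Polynomial.X ^ 8)), ?_⟩
  simp only [duodecicEliminant, Polynomial.derivative_add, Polynomial.derivative_sub,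
    Polynomial.derivative_mul, Polynomial.derivative_X_pow, Polynomial.derivative_ofNat,
    map_natCast]
  push_cast
  algebra

theorem isCoprime_components :
    IsCoprime (Ideal.span {X 0, R61}) (Ideal.span {quarticFactor, R61}) := by
  rw [Ideal.isCoprime_iff_exists]
  refine ⟨_, Ideal.mem_span_pair.2 ⟨(9 / 128 : ℚ) • (X 1 *
        (-27 * X 0 * X 1 ^ 2 + 9 * X 0 ^ 3 * X 1 - 28 * X 0)) -
      (1 / 16 : ℚ) • ((3 * X 1 ^ 2 + 4) * (X 0 ^ 3 - 5 * X 0 * X 1)),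
      (-9 / 128 : ℚ) • X 1, rfl⟩, _,
    Ideal.mem_span_pair.2 ⟨(1 / 16 : ℚ) • (3 * X 1 ^ 2 + 4), 0, rfl⟩, ?_⟩
  rw [R61, quarticFactor]
  algebra

/-- The component `x = 0` of `Spec A₁`. -/
noncomputable def quotientEquivCubic :
    (MvPolynomial (Fin 2) ℚ ⧸ Ideal.span {X 0, R61}) ≃ₐ[ℚ] AdjoinRoot cubicEliminant :=
  quotientEquivAdjoinRoot _ cubicEliminant ![0, Polynomial.X] (X 1)
    (Ideal.forall_mem_span_pair_dvd (φ := aeval ![0, Polynomial.X]) (by simp)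
      ⟨16, by simp [R61, cubicEliminant]; ring⟩)
    (Ideal.mem_span_pair.2
      ⟨(1 / 16 : ℚ) • (27 * X 0 * X 1 ^ 2 - 9 * X 0 ^ 3 * X 1 + 28 * X 0), (1 / 16 : ℚ) • 1, by
        simp only [R61, cubicEliminant, map_add, map_mul, map_pow, Polynomial.aeval_X,
          map_ofNat]
        algebra⟩)
    (by simp)
    (by simpa [Fin.forall_fin_two] using Ideal.subset_span (by simp))

theorem duodecicEliminant_mem :
    Polynomial.aeval (X 0) duodecicEliminant ∈ Ideal.span {quarticFactor, R61} := by
  rw [Ideal.mem_span_pair]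
  let l : MvPolynomial (Fin 2) ℚ :=
    (1 / 3 : ℚ) • ((384 - 91 * X 0 ^ 4) * X 1 - (340 * X 0 ^ 2 - 41 * X 0 ^ 6)) +
      (1 / 18 : ℚ) • (2160 * X 0 ^ 2 - 37 * X 0 ^ 6)
  refine ⟨(1 / 288 : ℚ) • (-147456 + 69888 * X 0 ^ 4 - 8281 * X 0 ^ 8) -
      (9 / 8 : ℚ) • (((8 / 3 : ℚ) • X 1 - (41 / 18 : ℚ) • X 0 ^ 2) * l), (9 / 8 : ℚ) • l, ?_⟩
  simp only [l, R61, quarticFactor, duodecicEliminant, map_add, map_sub, map_mul, map_pow,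
    Polynomial.aeval_X, map_ofNat]
  algebra

theorem X_one_sub_yOfX_mem :
    X 1 - Polynomial.aeval (X 0) yOfX ∈ Ideal.span {quarticFactor, R61} := by
  let h : MvPolynomial (Fin 2) ℚ :=
    (1 / 923673664 : ℚ) • (7125795 + 7287462 * X 0 ^ 4 - 74529 * X 0 ^ 8)
  have key : X 1 - Polynomial.aeval (X 0) yOfX =
      -(h * ((8 / 3 : ℚ) • X 1 - (41 / 18 : ℚ) • X 0 ^ 2)) * quarticFactor + h * R61 +
      (1 / 1847347328 : ℚ) • (339521 * X 0 ^ 2 - 753571 * X 1) *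
        Polynomial.aeval (X 0) duodecicEliminant := by
    simp only [h, R61, quarticFactor, duodecicEliminant, yOfX, map_add, map_sub, map_mul,
      map_pow, map_smul, Polynomial.aeval_X, map_ofNat]
    algebra
  rw [key]
  exact add_mem (Ideal.mem_span_pair.2 ⟨_, _, rfl⟩)
    (Ideal.mul_mem_left _ _ duodecicEliminant_mem)

theorem duodecicEliminant_dvd_aeval_quarticFactor :
    duodecicEliminant ∣ aeval ![Polynomial.X, yOfX] quarticFactor := by
  refine ⟨(1 / 7389389312 : ℚ) •
    (-14432401 - 2324322 * Polynomial.X ^ 4 + 24843 * Polynomial.X ^ 8), ?_⟩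
  simp only [quarticFactor, duodecicEliminant, map_add, map_sub, map_mul, map_pow, aeval_X,
    map_ofNat, Matrix.cons_val_zero, Matrix.cons_val_one]
  rw [yOfX]
  algebra

theorem duodecicEliminant_dvd_aeval_R61 :
    duodecicEliminant ∣ aeval ![Polynomial.X, yOfX] R61 := by
  refine ⟨(1 / 112289159985152 : ℚ) •
    (619135570499 * Polynomial.X ^ 2 - 11531715824 * Polynomial.X ^ 6 -
      6790429828 * Polynomial.X ^ 10 + 144188772 * Polynomial.X ^ 14 -
      753571 * Polynomial.X ^ 18), ?_⟩
  simp only [R61, duodecicEliminant, map_add, map_sub, map_mul, map_pow, aeval_X,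
    map_ofNat, Matrix.cons_val_zero, Matrix.cons_val_one]
  rw [yOfX]
  algebra

/-- The component `x ≠ 0` of `Spec A₁`. -/
noncomputable def quotientEquivDuodecic :
    (MvPolynomial (Fin 2) ℚ ⧸ Ideal.span {quarticFactor, R61}) ≃ₐ[ℚ]
      AdjoinRoot duodecicEliminant :=
  quotientEquivAdjoinRoot _ duodecicEliminant ![Polynomial.X, yOfX] (X 0)
    (Ideal.forall_mem_span_pair_dvd duodecicEliminant_dvd_aeval_quarticFactor
      duodecicEliminant_dvd_aeval_R61)
    duodecicEliminant_mem (by simp)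
    (by simpa [Fin.forall_fin_two] using X_one_sub_yOfX_mem)

/-- `A₁` is the product of its components `x = 0` and `x ≠ 0`. -/
noncomputable def quotientEquivProd :
    (MvPolynomial (Fin 2) ℚ ⧸ Ideal.span {R51, R61}) ≃ₐ[ℚ]
      AdjoinRoot cubicEliminant × AdjoinRoot duodecicEliminant :=
  (((Ideal.quotEquivOfEq (by rw [R51_eq, Ideal.span_mul_pair_eq_inf isCoprime_components])).trans
    (Ideal.quotientInfEquivQuotientProd _ _ isCoprime_components)).toRatAlgEquiv).trans
    (quotientEquivCubic.prodCongr quotientEquivDuodecic)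

/-- The specialized quantum cohomology ring `A₁ = ℚ[x,y]/⟨R₅(1), R₆(1)⟩` is a
finite-dimensional `ℚ`-algebra of dimension `15` which is a semisimple ring. -/
theorem stmt_5 :
    FiniteDimensional ℚ (MvPolynomial (Fin 2) ℚ ⧸ Ideal.span {R51, R61}) ∧
    Module.finrank ℚ (MvPolynomial (Fin 2) ℚ ⧸ Ideal.span {R51, R61}) = 15 ∧
    IsSemisimpleRing (MvPolynomial (Fin 2) ℚ ⧸ Ideal.span {R51, R61}) := by
  have hc := separable_cubicEliminant
  have hd := separable_duodecicEliminant
  have : Module.Finite ℚ (AdjoinRoot cubicEliminant) :=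
    (AdjoinRoot.powerBasis hc.ne_zero).finite
  have : Module.Finite ℚ (AdjoinRoot duodecicEliminant) :=
    (AdjoinRoot.powerBasis hd.ne_zero).finite
  have := AdjoinRoot.isSemisimpleRing_of_separable hc
  have := AdjoinRoot.isSemisimpleRing_of_separable hd
  refine ⟨Module.Finite.equiv quotientEquivProd.symm.toLinearEquiv, ?_,
    quotientEquivProd.symm.toRingEquiv.isSemisimpleRing⟩
  rw [quotientEquivProd.toLinearEquiv.finrank_eq, Module.finrank_prod,
    AdjoinRoot.finrank_eq_natDegree hc.ne_zero, AdjoinRoot.finrank_eq_natDegree hd.ne_zero,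
    natDegree_cubicEliminant, natDegree_duodecicEliminant]
end

section
/- The set of pairs (a,b) ∈ ℂ × ℂ satisfying a⁵ − 5a³b + 6ab² + 4a = 0 and 16b³ − 27a²b² + 9a⁴b + 32b − 28a² = 0 is finite with exactly 15 elements. -/
open Polynomial in
/-- The sextic `u⁶ + 2u⁴ − 3u² − 8` is separable, so it has six distinct complex roots. -/
lemma exists_finset_roots_sextic :
    ∃ R : Finset ℂ, R.card = 6 ∧ ∀ u : ℂ, u ∈ R ↔ u ^ 6 + 2 * u ^ 4 - 3 * u ^ 2 - 8 = 0 := by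
  set P : ℂ[X] := X ^ 6 + C 2 * X ^ 4 - C 3 * X ^ 2 - C 8 with hP
  have hdeg : P.natDegree = 6 := by rw [hP]; compute_degree!
  have hP0 : P ≠ 0 := by
    intro h
    simp [h] at hdeg
  have hder : derivative P = 6 * X ^ 5 + 8 * X ^ 3 - 6 * X := by
    rw [hP]
    simp only [derivative_add, derivative_sub, derivative_mul, derivative_C, derivative_X_pow]
    simp only [map_ofNat, Nat.cast_ofNat]
    ring
  have hsep : P.Separable := by
    have hC : (C (1 / 3712) : ℂ[X]) * 3712 = 1 := by
      rw [← map_ofNat (C : ℂ →+* ℂ[X]) 3712, ← C_mul]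
      norm_num
    refine ⟨C (1 / 3712) * (2 * (8 * (39 * X ^ 2 - 47) -
      (-13 * X ^ 4 + 7 * X ^ 2 + 48) * (3 * X ^ 4 + 4 * X ^ 2 - 3))),
      C (1 / 3712) * ((-13 * X ^ 4 + 7 * X ^ 2 + 48) * X * (X ^ 4 + 2 * X ^ 2 - 3)), ?_⟩
    rw [hder, hP]
    simp only [map_ofNat]
    linear_combination hC
  refine ⟨P.roots.toFinset, ?_, fun u => ?_⟩
  · rw [Multiset.toFinset_card_of_nodup (nodup_roots hsep),
      ← (IsAlgClosed.splits P).natDegree_eq_card_roots, hdeg]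
  · rw [Multiset.mem_toFinset, mem_roots hP0, IsRoot.def, hP]
    simp

/-- The set of pairs `(a,b) ∈ ℂ × ℂ` with `a⁵ − 5a³b + 6ab² + 4a = 0` and
`16b³ − 27a²b² + 9a⁴b + 32b − 28a² = 0` is finite with exactly `15` elements. -/
theorem stmt_6 :
    ({p : ℂ × ℂ | p.1 ^ 5 - 5 * p.1 ^ 3 * p.2 + 6 * p.1 * p.2 ^ 2 + 4 * p.1 = 0 ∧
        16 * p.2 ^ 3 - 27 * p.1 ^ 2 * p.2 ^ 2 + 9 * p.1 ^ 4 * p.2 + 32 * p.2 -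
          28 * p.1 ^ 2 = 0}).Finite ∧
    ({p : ℂ × ℂ | p.1 ^ 5 - 5 * p.1 ^ 3 * p.2 + 6 * p.1 * p.2 ^ 2 + 4 * p.1 = 0 ∧
        16 * p.2 ^ 3 - 27 * p.1 ^ 2 * p.2 ^ 2 + 9 * p.1 ^ 4 * p.2 + 32 * p.2 -
          28 * p.1 ^ 2 = 0}).ncard = 15 := by
  classical
  obtain ⟨R, hRcard, hR⟩ := exists_finset_roots_sextic
  obtain ⟨t, ht⟩ := IsAlgClosed.exists_pow_nat_eq (-2 : ℂ) (n := 2) (by norm_num)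
  choose r hr using fun u : ℂ =>
    IsAlgClosed.exists_pow_nat_eq (3 * u + 8 * u⁻¹) (n := 2) (by norm_num)
  have ht0 : t ≠ 0 := by
    rintro rfl
    norm_num at ht
  have hu0 : ∀ u ∈ R, u ≠ 0 := by
    rintro u hu rfl
    have := (hR 0).1 hu
    norm_num at this
  have hr0 : ∀ u ∈ R, r u ≠ 0 := by
    intro u hu h
    have h1 := hr u
    have h2 := (hR u).1 hu
    have h3 := mul_inv_cancel₀ (hu0 u hu)
    rw [h] at h1
    have h4 : 3 * u ^ 2 = -8 := by linear_combination (-u) * h1 - 8 * h3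
    have h5 : u ^ 2 = -8 / 3 := by linear_combination h4 / 3
    have h6 : (u ^ 2) ^ 3 + 2 * (u ^ 2) ^ 2 - 3 * u ^ 2 - 8 = 0 := by linear_combination h2
    rw [h5] at h6
    norm_num at h6
  set A : Finset (ℂ × ℂ) := {(0, 0), (0, t), (0, -t)} with hA
  set f : ℂ × ℂ → ℂ × ℂ := fun q => (q.2 * r q.1, q.1 + 4 * q.1⁻¹) with hf
  set B : Finset (ℂ × ℂ) := (R ×ˢ ({1, -1} : Finset ℂ)).image f with hB
  have hsq : ∀ e ∈ ({1, -1} : Finset ℂ), e ^ 2 = 1 := by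
    intro e he
    rw [Finset.mem_insert, Finset.mem_singleton] at he
    rcases he with rfl | rfl <;> norm_num
  have hAcard : A.card = 3 := by
    refine Finset.card_eq_three.2 ⟨_, _, _, ?_, ?_, ?_, hA⟩ <;>
      simp [ht0, ht0.symm, self_eq_neg]
  have hBcard : B.card = 12 := by
    rw [hB, Finset.card_image_of_injOn, Finset.card_product, hRcard,
      Finset.card_pair (by norm_num)]
    rintro ⟨u, e⟩ hq ⟨v, d⟩ hq' h
    rw [Finset.mem_coe, Finset.mem_product] at hq hq'
    simp only [hf, Prod.mk.injEq] at h
    have he := hsq e hq.2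
    have hd := hsq d hq'.2
    have huv : u = v := by
      linear_combination (e * r u + d * r v) * h.1 - 2 * h.2 - r u ^ 2 * he + r v ^ 2 * hd
        - hr u + hr v
    subst huv
    rw [mul_right_cancel₀ (hr0 u hq.1) h.1]
  have hdisj : Disjoint A B := by
    rw [Finset.disjoint_left]
    intro p hpA hpB
    obtain ⟨⟨u, e⟩, hq, rfl⟩ := Finset.mem_image.1 hpB
    rw [Finset.mem_product] at hq
    have he := hsq e hq.2
    have he0 : e ≠ 0 := by
      rintro rfl
      norm_num at he
    simp [hA, hf, he0, hr0 u hq.1] at hpA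
  have hS : {p : ℂ × ℂ | p.1 ^ 5 - 5 * p.1 ^ 3 * p.2 + 6 * p.1 * p.2 ^ 2 + 4 * p.1 = 0 ∧
        16 * p.2 ^ 3 - 27 * p.1 ^ 2 * p.2 ^ 2 + 9 * p.1 ^ 4 * p.2 + 32 * p.2 -
          28 * p.1 ^ 2 = 0} = ↑(A ∪ B) := by
    ext ⟨a, b⟩
    rw [Finset.mem_coe, Finset.mem_union, Set.mem_ofPred_eq]
    constructor
    · rintro ⟨h1, h2⟩
      dsimp only at h1 h2
      by_cases ha : a = 0
      · left
        subst ha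
        have h3 : b * ((b - t) * (b + t)) = 0 := by linear_combination h2 / 16 - b * ht
        rcases mul_eq_zero.1 h3 with h | h
        · simp [hA, h]
        rcases mul_eq_zero.1 h with h | h
        · simp [hA, sub_eq_zero.1 h]
        · simp [hA, eq_neg_of_add_eq_zero_left h]
      · right
        have h3 : (a ^ 2 - 2 * b) * (a ^ 2 - 3 * b) = -4 :=
          mul_left_cancel₀ ha (by linear_combination h1)
        obtain ⟨u, hu⟩ : ∃ u, u = a ^ 2 - 2 * b := ⟨_, rfl⟩
        obtain ⟨v, hv⟩ : ∃ v, v = a ^ 2 - 3 * b := ⟨_, rfl⟩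
        rw [← hu, ← hv] at h3
        have hb : b = u - v := by linear_combination hv - hu
        have ha2 : a ^ 2 = 3 * u - 2 * v := by linear_combination 2 * hv - 3 * hu
        have hune : u ≠ 0 := by
          rintro rfl
          norm_num at h3
        have hvu : v = -4 * u⁻¹ := by
          field_simp
          linear_combination h3
        have h4 : 16 * b ^ 3 - 27 * a ^ 2 * b ^ 2 + 9 * (a ^ 2) ^ 2 * b + 32 * b -
          28 * a ^ 2 = 0 := by linear_combination h2
        rw [ha2, hb] at h4
        have h5 : 8 * u ^ 3 + 16 * u + 6 * v + v ^ 3 = 0 := by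
          linear_combination h4 / 2 + (21 * u - 3 * v) / 2 * h3
        have huR : u ∈ R := by
          rw [hR]
          linear_combination u ^ 3 / 8 * h5 - (6 * u ^ 2 + (u * v) ^ 2 - 4 * (u * v) + 16) / 8 * h3
        have h6 : (a - r u) * (a + r u) = 0 := by
          linear_combination ha2 - hr u - 2 * hvu
        have hb' : u + 4 * u⁻¹ = b := by
          linear_combination -hb + hvu
        rw [hB, Finset.mem_image]
        rcases mul_eq_zero.1 h6 with h | h
        · refine ⟨(u, 1), by simp [huR], ?_⟩
          simp [hf, hb', sub_eq_zero.1 h]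
        · refine ⟨(u, -1), by simp [huR], ?_⟩
          simp [hf, hb', eq_neg_of_add_eq_zero_left h]
    · rintro (h | h)
      · simp only [hA, Finset.mem_insert, Finset.mem_singleton, Prod.mk.injEq] at h
        rcases h with ⟨rfl, rfl⟩ | ⟨rfl, rfl⟩ | ⟨rfl, rfl⟩
        · norm_num
        · exact ⟨by ring, by linear_combination 16 * b * ht⟩
        · exact ⟨by ring, by linear_combination -16 * t * ht⟩
      · obtain ⟨⟨u, e⟩, hq, h⟩ := Finset.mem_image.1 h
        rw [Finset.mem_product] at hq
        simp only [hf, Prod.mk.injEq] at h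
        have hu := (hR u).1 hq.1
        have hi := mul_inv_cancel₀ (hu0 u hq.1)
        have ha2 : a ^ 2 = 3 * u + 8 * u⁻¹ := by
          rw [← h.1, mul_pow, hsq e hq.2, hr, one_mul]
        have hb : b = u + 4 * u⁻¹ := h.2.symm
        have e1 : (a ^ 2) ^ 2 - 5 * a ^ 2 * b + 6 * b ^ 2 + 4 = 0 := by
          rw [ha2, hb]
          linear_combination -4 * hi
        have e2 : 16 * b ^ 3 - 27 * a ^ 2 * b ^ 2 + 9 * (a ^ 2) ^ 2 * b + 32 * b -
            28 * a ^ 2 = 0 := by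
          have hne := hu0 u hq.1
          rw [ha2, hb]
          field_simp
          linear_combination 16 * hu
        exact ⟨by linear_combination a * e1, by linear_combination e2⟩
  rw [hS]
  refine ⟨Finset.finite_toSet _, ?_⟩
  rw [Set.ncard_coe_finset, Finset.card_union_of_disjoint hdisj, hAcard, hBcard]
end

section
/- The ℂ-algebra ℂ[x,y]/⟨x⁵ − 5x³y + 6xy² + 4x, 16y³ − 27x²y² + 9x⁴y + 32y − 28x²⟩ is isomorphic, as a ℂ-algebra, to the product of 15 copies of ℂ. -/
open MvPolynomial

/-- `R₅(1) = x⁵ − 5x³y + 6xy² + 4x` over `ℂ`, with `x = X 0`, `y = X 1`. -/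
noncomputable def R51C : MvPolynomial (Fin 2) ℂ :=
  X 0 ^ 5 - 5 * X 0 ^ 3 * X 1 + 6 * X 0 * X 1 ^ 2 + 4 * X 0

/-- `R₆(1) = 16y³ − 27x²y² + 9x⁴y + 32y − 28x²` over `ℂ`. -/
noncomputable def R61C : MvPolynomial (Fin 2) ℂ :=
  16 * X 1 ^ 3 - 27 * X 0 ^ 2 * X 1 ^ 2 + 9 * X 0 ^ 4 * X 1 + 32 * X 1 - 28 * X 0 ^ 2

/-- A `K`-algebra of dimension at most `card ι` with a family of distinct characters indexed by `ι`
is isomorphic to `ι → K`. -/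
theorem nonempty_algEquiv_pi_of_injective_algHom {K A ι : Type*} [Field K] [CommRing A]
    [Algebra K A] [Module.Finite K A] [Fintype ι] (φ : ι → A →ₐ[K] K)
    (hφ : Function.Injective φ) (hA : Module.finrank K A ≤ Fintype.card ι) :
    Nonempty (A ≃ₐ[K] (ι → K)) := by
  classical
  have hli : LinearIndependent K fun i => (φ i).toLinearMap :=
    (linearIndependent_toLinearMap K A K).comp φ hφ
  have hsurj : Function.Surjective (AlgHom.pi φ).toLinearMap := by
    rw [← LinearMap.range_eq_top]
    by_contra h
    obtain ⟨f, hf0, hf⟩ := Submodule.exists_le_ker_of_lt_top _ (lt_top_iff_ne_top.2 h)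
    have hzero : ∑ i, f (Pi.single i 1) • (φ i).toLinearMap = 0 := by
      ext a
      have ha : f (AlgHom.pi φ a) = 0 := hf ⟨a, rfl⟩
      rw [pi_eq_sum_univ' (AlgHom.pi φ a), map_sum] at ha
      simp only [map_smul] at ha
      simpa [mul_comm] using ha
    have hcoef := Fintype.linearIndependent_iff.1 hli _ hzero
    apply hf0
    ext i
    simpa using hcoef i
  have hrank : Module.finrank K A = Module.finrank K (ι → K) := by
    refine le_antisymm (by simpa using hA) ?_
    exact LinearMap.finrank_le_finrank_of_surjective hsurj
  have hinj := (LinearMap.injective_iff_surjective_of_finrank_eq_finrank hrank).2 hsurj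
  exact ⟨AlgEquiv.ofBijective (AlgHom.pi φ) ⟨hinj, hsurj⟩⟩

/-- Given the two relations, the fifteen monomials `x ^ i * y ^ j` with `i < 5` and `j < 3` span
a subspace stable under multiplication by `x` and `y`. -/
theorem mul_mem_span_monomials {A : Type*} [CommRing A] [Algebra ℂ A] {x y : A}
    (h5 : x ^ 5 - 5 * x ^ 3 * y + 6 * x * y ^ 2 + 4 * x = 0)
    (h6 : 16 * y ^ 3 - 27 * x ^ 2 * y ^ 2 + 9 * x ^ 4 * y + 32 * y - 28 * x ^ 2 = 0) {s : A}
    (hs : s ∈ Submodule.span ℂ (Set.range fun p : Fin 5 × Fin 3 => x ^ (p.1 : ℕ) * y ^ (p.2 : ℕ))) :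
    x * s ∈ Submodule.span ℂ
        (Set.range fun p : Fin 5 × Fin 3 => x ^ (p.1 : ℕ) * y ^ (p.2 : ℕ)) ∧
      y * s ∈ Submodule.span ℂ
        (Set.range fun p : Fin 5 × Fin 3 => x ^ (p.1 : ℕ) * y ^ (p.2 : ℕ)) := by
  set S := Submodule.span ℂ
    (Set.range fun p : Fin 5 × Fin 3 => x ^ (p.1 : ℕ) * y ^ (p.2 : ℕ)) with hS
  have hb (i j : ℕ) (hi : i < 5) (hj : j < 3) : x ^ i * y ^ j ∈ S :=
    Submodule.subset_span ⟨(⟨i, hi⟩, ⟨j, hj⟩), rfl⟩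
  have hc (c : ℂ) (i j : ℕ) (hi : i < 5) (hj : j < 3) : c • (x ^ i * y ^ j) ∈ S :=
    S.smul_mem c (hb i j hi hj)
  have h50 : x ^ 5 * y ^ 0 ∈ S := by
    have e : x ^ 5 * y ^ 0 = (-4 : ℂ) • (x ^ 1 * y ^ 0) + (-6 : ℂ) • (x ^ 1 * y ^ 2)
        + (5 : ℂ) • (x ^ 3 * y ^ 1) := by
      linear_combination (norm := algebra) h5
    rw [e]
    exact add_mem (add_mem (hc _ 1 0 (by simp) (by simp)) (hc _ 1 2 (by simp) (by simp)))
      (hc _ 3 1 (by simp) (by simp))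
  have h51 : x ^ 5 * y ^ 1 ∈ S := by
    have e : x ^ 5 * y ^ 1 = (-64 / 19 : ℂ) • (x ^ 1 * y ^ 1) + (84 / 19 : ℂ) • (x ^ 3 * y ^ 0)
        + (41 / 19 : ℂ) • (x ^ 3 * y ^ 2) := by
      linear_combination (norm := algebra) ((-8 / 19 : ℂ) • y) * h5 + ((3 / 19 : ℂ) • x) * h6
    rw [e]
    exact add_mem (add_mem (hc _ 1 1 (by simp) (by simp)) (hc _ 3 0 (by simp) (by simp)))
      (hc _ 3 2 (by simp) (by simp))
  have h52 : x ^ 5 * y ^ 2 ∈ S := by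
    have e : x ^ 5 * y ^ 2 = (-287 : ℂ) • (x ^ 1 * y ^ 0) + (-557 / 2 : ℂ) • (x ^ 1 * y ^ 2)
        + (339 / 2 : ℂ) • (x ^ 3 * y ^ 1) := by
      linear_combination (norm := algebra)
        ((287 / 4 : ℂ) • (1 : A) + (19 : ℂ) • y ^ 2 - (369 / 16 : ℂ) • (x ^ 2 * y)) * h5
          + ((-57 / 8 : ℂ) • (x * y) + (41 / 16 : ℂ) • x ^ 3) * h6
    rw [e]
    exact add_mem (add_mem (hc _ 1 0 (by simp) (by simp)) (hc _ 1 2 (by simp) (by simp)))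
      (hc _ 3 1 (by simp) (by simp))
  have h03 : x ^ 0 * y ^ 3 ∈ S := by
    have e : x ^ 0 * y ^ 3 = (-2 : ℂ) • (x ^ 0 * y ^ 1) + (7 / 4 : ℂ) • (x ^ 2 * y ^ 0)
        + (27 / 16 : ℂ) • (x ^ 2 * y ^ 2) + (-9 / 16 : ℂ) • (x ^ 4 * y ^ 1) := by
      linear_combination (norm := algebra) ((1 / 16 : ℂ) • (1 : A)) * h6
    rw [e]
    exact add_mem (add_mem (add_mem (hc _ 0 1 (by simp) (by simp)) (hc _ 2 0 (by simp) (by simp)))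
      (hc _ 2 2 (by simp) (by simp))) (hc _ 4 1 (by simp) (by simp))
  have e13 : x * y ^ 3 = (-2 / 19 : ℂ) • (x ^ 1 * y ^ 1) + (-14 / 19 : ℂ) • (x ^ 3 * y ^ 0)
      + (9 / 19 : ℂ) • (x ^ 3 * y ^ 2) := by
    linear_combination (norm := algebra) ((9 / 38 : ℂ) • y) * h5 + ((-1 / 38 : ℂ) • x) * h6
  have h13 : x ^ 1 * y ^ 3 ∈ S := by
    rw [pow_one, e13]
    exact add_mem (add_mem (hc _ 1 1 (by simp) (by simp)) (hc _ 3 0 (by simp) (by simp)))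
      (hc _ 3 2 (by simp) (by simp))
  have h23 : x ^ 2 * y ^ 3 ∈ S := by
    have e : x ^ 2 * y ^ 3 = (-2 / 19 : ℂ) • (x ^ 2 * y ^ 1) + (-14 / 19 : ℂ) • (x ^ 4 * y ^ 0)
        + (9 / 19 : ℂ) • (x ^ 4 * y ^ 2) := by
      linear_combination (norm := algebra) x * e13
    rw [e]
    exact add_mem (add_mem (hc _ 2 1 (by simp) (by simp)) (hc _ 4 0 (by simp) (by simp)))
      (hc _ 4 2 (by simp) (by simp))
  have e33 : x ^ 3 * y ^ 3 = (-133 : ℂ) • (x ^ 1 * y ^ 0) + (-255 / 2 : ℂ) • (x ^ 1 * y ^ 2)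
      + (153 / 2 : ℂ) • (x ^ 3 * y ^ 1) := by
    linear_combination (norm := algebra)
      ((133 / 4 : ℂ) • (1 : A) + (9 : ℂ) • y ^ 2 - (171 / 16 : ℂ) • (x ^ 2 * y)) * h5
        + ((-27 / 8 : ℂ) • (x * y) + (19 / 16 : ℂ) • x ^ 3) * h6
  have h33 : x ^ 3 * y ^ 3 ∈ S := by
    rw [e33]
    exact add_mem (add_mem (hc _ 1 0 (by simp) (by simp)) (hc _ 1 2 (by simp) (by simp)))
      (hc _ 3 1 (by simp) (by simp))
  have h43 : x ^ 4 * y ^ 3 ∈ S := by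
    have e : x ^ 4 * y ^ 3 = (-133 : ℂ) • (x ^ 2 * y ^ 0) + (-255 / 2 : ℂ) • (x ^ 2 * y ^ 2)
        + (153 / 2 : ℂ) • (x ^ 4 * y ^ 1) := by
      linear_combination (norm := algebra) x * e33
    rw [e]
    exact add_mem (add_mem (hc _ 2 0 (by simp) (by simp)) (hc _ 2 2 (by simp) (by simp)))
      (hc _ 4 1 (by simp) (by simp))
  constructor
  · have hle : S ≤ S.comap (LinearMap.mulLeft ℂ x) := by
      rw [hS, Submodule.span_le, ← hS]
      rintro _ ⟨⟨⟨i, hi⟩, ⟨j, hj⟩⟩, rfl⟩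
      simp only [SetLike.mem_coe, Submodule.mem_comap, LinearMap.mulLeft_apply]
      rw [← mul_assoc, ← pow_succ']
      by_cases hi' : i < 4
      · exact hb _ _ (by lia) hj
      · obtain rfl : i = 4 := by lia
        interval_cases j <;> assumption
    exact hle hs
  · have hle : S ≤ S.comap (LinearMap.mulLeft ℂ y) := by
      rw [hS, Submodule.span_le, ← hS]
      rintro _ ⟨⟨⟨i, hi⟩, ⟨j, hj⟩⟩, rfl⟩
      simp only [SetLike.mem_coe, Submodule.mem_comap, LinearMap.mulLeft_apply]
      rw [mul_left_comm, ← pow_succ']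
      by_cases hj' : j < 2
      · exact hb _ _ hi (by lia)
      · obtain rfl : j = 2 := by lia
        interval_cases i <;> assumption
    exact hle hs

/-- The fifteen monomials `x ^ i * y ^ j` with `i < 5` and `j < 3` span the quotient ring. -/
theorem span_monomials_quotient_eq_top :
    Submodule.span ℂ (Set.range fun p : Fin 5 × Fin 3 =>
      (Ideal.Quotient.mk (Ideal.span {R51C, R61C}) (X 0)) ^ (p.1 : ℕ) *
        (Ideal.Quotient.mk (Ideal.span {R51C, R61C}) (X 1)) ^ (p.2 : ℕ)) = ⊤ := by
  set I := Ideal.span {R51C, R61C} with hI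
  have h5 : Ideal.Quotient.mk I R51C = 0 :=
    Ideal.Quotient.eq_zero_iff_mem.2 (Ideal.subset_span (by simp))
  have h6 : Ideal.Quotient.mk I R61C = 0 :=
    Ideal.Quotient.eq_zero_iff_mem.2 (Ideal.subset_span (by simp))
  simp only [R51C, R61C, map_add, map_sub, map_mul, map_pow, map_ofNat] at h5 h6
  rw [eq_top_iff]
  rintro a -
  obtain ⟨p, rfl⟩ := Ideal.Quotient.mk_surjective a
  induction p using MvPolynomial.induction_on with
  | C c =>
    have hC : Ideal.Quotient.mk I (C c) = c • (1 : MvPolynomial (Fin 2) ℂ ⧸ I) := by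
      rw [← Algebra.algebraMap_eq_smul_one]
      rfl
    rw [hC]
    exact Submodule.smul_mem _ _ (Submodule.subset_span ⟨(0, 0), by simp⟩)
  | add p q hp hq =>
    rw [map_add]
    exact add_mem hp hq
  | mul_X p i hp =>
    rw [map_mul, mul_comm]
    fin_cases i
    · exact (mul_mem_span_monomials h5 h6 hp).1
    · exact (mul_mem_span_monomials h5 h6 hp).2

/-- The first coordinates of the common zeros of `R51C` and `R61C` off the line `x = 0` are the
roots of a separable polynomial of degree twelve. -/
theorem separable_eliminant :
    (Polynomial.X ^ 12 - 102 * Polynomial.X ^ 8 + 317 * Polynomial.X ^ 4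
      - 2048 : Polynomial ℂ).Separable := by
  rw [Polynomial.separable_def]
  have hd : Polynomial.derivative (Polynomial.X ^ 12 - 102 * Polynomial.X ^ 8
      + 317 * Polynomial.X ^ 4 - 2048 : Polynomial ℂ)
      = 12 * Polynomial.X ^ 11 - 816 * Polynomial.X ^ 7 + 1268 * Polynomial.X ^ 3 := by
    simp only [Polynomial.derivative_sub, Polynomial.derivative_add, Polynomial.derivative_mul,
      Polynomial.derivative_X_pow,
      Polynomial.derivative_ofNat, Nat.cast_ofNat, map_ofNat]
    ring
  rw [hd]
  have hu : (Polynomial.C (1 / 3428676640768) * 3428676640768 : Polynomial ℂ) = 1 := by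
    rw [← map_ofNat (Polynomial.C : ℂ →+* Polynomial ℂ), ← Polynomial.C_mul, ← Polynomial.C_1]
    norm_num
  refine ⟨Polynomial.C (1 / 3428676640768) *
      (-1674158516 - 150623184 * Polynomial.X ^ 4 + 2642100 * Polynomial.X ^ 8),
    Polynomial.C (1 / 3428676640768) *
      (175261805 * Polynomial.X + 20037882 * Polynomial.X ^ 5 - 220175 * Polynomial.X ^ 9), ?_⟩
  rw [← hu]
  ring

theorem card_roots_eliminant :
    (Polynomial.X ^ 12 - 102 * Polynomial.X ^ 8 + 317 * Polynomial.X ^ 4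
      - 2048 : Polynomial ℂ).roots.toFinset.card = 12 := by
  rw [Multiset.toFinset_card_of_nodup (Polynomial.nodup_roots separable_eliminant),
    ← (IsAlgClosed.splits _).natDegree_eq_card_roots]
  compute_degree!

/-- The polynomials `R51C` and `R61C` have fifteen distinct common zeros. -/
theorem exists_common_zeros : ∃ T : Finset (ℂ × ℂ), T.card = 15 ∧
    ∀ p ∈ T, aeval ![p.1, p.2] R51C = (0 : ℂ) ∧ aeval ![p.1, p.2] R61C = (0 : ℂ) := by
  classical
  obtain ⟨c, hc⟩ := IsAlgClosed.exists_pow_nat_eq (-2 : ℂ) (n := 2) (by norm_num)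
  have hc0 : c ≠ 0 := by
    rintro rfl
    norm_num at hc
  let g : ℂ → ℂ := fun w => 63473 / 121568 + 4449 / 60784 * w - 91 / 121568 * w ^ 2
  let Q : Polynomial ℂ := .X ^ 12 - 102 * .X ^ 8 + 317 * .X ^ 4 - 2048
  have hQ (x : ℂ) (hx : x ∈ Q.roots.toFinset) :
      x ^ 12 - 102 * x ^ 8 + 317 * x ^ 4 - 2048 = 0 := by
    simpa [Q] using (Polynomial.mem_roots'.1 (Multiset.mem_toFinset.1 hx)).2
  refine ⟨Q.roots.toFinset.image (fun x => (x, x ^ 2 * g (x ^ 4))) ∪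
    {(0, 0), (0, c), (0, -c)}, ?_, ?_⟩
  · rw [Finset.card_union_of_disjoint, Finset.card_image_of_injective, card_roots_eliminant]
    · have h3 : ({(0, 0), (0, c), (0, -c)} : Finset (ℂ × ℂ)).card = 3 := by
        rw [Finset.card_eq_three]
        exact ⟨_, _, _, by simpa using hc0.symm, by simpa using hc0,
          by simpa using self_ne_neg.2 hc0, rfl⟩
      rw [h3]
    · exact fun a b h => congrArg Prod.fst h
    · rw [Finset.disjoint_left]
      intro p hp hp'
      obtain ⟨x, hx, rfl⟩ := Finset.mem_image.1 hp
      have hx0 : x = 0 := by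
        simp only [Finset.mem_insert, Finset.mem_singleton, Prod.mk.injEq] at hp'
        tauto
      have := hQ x hx
      norm_num [hx0] at this
  · intro p hp
    simp only [R51C, R61C, map_add, map_sub, map_mul, map_pow, map_ofNat, aeval_X,
      Matrix.cons_val_zero, Matrix.cons_val_one]
    rcases Finset.mem_union.1 hp with hp | hp
    · obtain ⟨x, hx, rfl⟩ := Finset.mem_image.1 hp
      have h := hQ x hx
      simp only [g]
      constructor
      · linear_combination x * (-1 / 512 - 1162161 / 3694694656 * x ^ 4
          + 24843 / 7389389312 * x ^ 8) * h
      · linear_combination x ^ 2 * (42899 / 7780352 - 720732239 / 7018072499072 * x ^ 4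
          - 1697607457 / 28072289996288 * x ^ 8 + 36047193 / 28072289996288 * x ^ 12
          - 753571 / 112289159985152 * x ^ 16) * h
    · simp only [Finset.mem_insert, Finset.mem_singleton] at hp
      rcases hp with rfl | rfl | rfl
      · norm_num
      · exact ⟨by ring, by linear_combination 16 * c * hc⟩
      · exact ⟨by ring, by linear_combination -16 * c * hc⟩

/-- The `ℂ`-algebra `ℂ[x,y]/⟨R₅(1), R₆(1)⟩` is isomorphic, as a `ℂ`-algebra, to the
product of `15` copies of `ℂ`. -/
theorem stmt_7 :
    Nonempty ((MvPolynomial (Fin 2) ℂ ⧸ Ideal.span {R51C, R61C}) ≃ₐ[ℂ] (Fin 15 → ℂ)) := by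
  have hspan := span_monomials_quotient_eq_top
  have hfin : Module.Finite ℂ (MvPolynomial (Fin 2) ℂ ⧸ Ideal.span {R51C, R61C}) :=
    ⟨hspan ▸ Submodule.fg_span (Set.finite_range _)⟩
  have hrank : Module.finrank ℂ (MvPolynomial (Fin 2) ℂ ⧸ Ideal.span {R51C, R61C}) ≤ 15 := by
    rw [← finrank_top, ← hspan]
    exact (finrank_range_le_card _).trans (by simp)
  obtain ⟨T, hT, hzero⟩ := exists_common_zeros
  have hker (p : T) : ∀ a ∈ Ideal.span {R51C, R61C}, aeval ![p.1.1, p.1.2] a = (0 : ℂ) := by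
    intro a ha
    have hle : Ideal.span {R51C, R61C} ≤
        RingHom.ker (aeval ![p.1.1, p.1.2] : MvPolynomial (Fin 2) ℂ →ₐ[ℂ] ℂ) := by
      rw [Ideal.span_le]
      rintro _ (rfl | rfl)
      · exact (hzero p p.2).1
      · exact (hzero p p.2).2
    exact hle ha
  let φ (p : T) := Ideal.Quotient.liftₐ (Ideal.span {R51C, R61C}) (aeval ![p.1.1, p.1.2]) (hker p)
  have hφ (p : T) (i : Fin 2) : φ p (Ideal.Quotient.mk _ (X i)) = ![p.1.1, p.1.2] i :=
    aeval_X _ i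
  have hinj : Function.Injective φ := by
    intro p q hpq
    have h (i : Fin 2) : ![p.1.1, p.1.2] i = ![q.1.1, q.1.2] i := by
      rw [← hφ, ← hφ, hpq]
    exact Subtype.ext (Prod.ext (h 0) (h 1))
  let e : Fin 15 ≃ T := (T.equivFinOfCardEq hT).symm
  exact nonempty_algEquiv_pi_of_injective_algHom (φ ∘ e) (hinj.comp e.injective)
    (by simpa using hrank)
end

section
/- The polynomial x¹⁵ − 102x¹¹ + 317x⁷ − 2048x³ (viewed in ℚ[x,y]) belongs to the ideal of ℚ[x,y] generated by x⁵ − 5x³y + 6xy² + 4x and 16y³ − 27x²y² + 9x⁴y + 32y − 28x². -/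
open MvPolynomial

/-- `x¹⁵ − 102x¹¹ + 317x⁷ − 2048x³` belongs to the ideal `⟨R₅(1), R₆(1)⟩` of `ℚ[x,y]`. -/
theorem stmt_8 :
    X 0 ^ 15 - 102 * X 0 ^ 11 + 317 * X 0 ^ 7 - 2048 * X 0 ^ 3 ∈
      Ideal.span ({R51, R61} : Set (MvPolynomial (Fin 2) ℚ)) := by
  have h16 : (C (1 / 16) * 16 : MvPolynomial (Fin 2) ℚ) = 1 := by
    rw [← map_ofNat (C (σ := Fin 2) (R := ℚ)) 16, ← C_mul, ← C_1]
    norm_num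
  refine Ideal.mem_span_pair.mpr
    ⟨C (1 / 16) * (16 * X 0 ^ 10 - 1531 * X 0 ^ 8 * X 1 + 5830 * X 0 ^ 6 * X 1 ^ 2
        - 15072 * X 0 ^ 4 * X 1 ^ 3 + 9216 * X 0 ^ 2 * X 1 ^ 4 + 3316 * X 0 ^ 6
        - 10240 * X 0 ^ 4 * X 1 + 12288 * X 0 ^ 2 * X 1 ^ 2 - 8192 * X 0 ^ 2),
      C (1 / 16) * (179 * X 0 ^ 9 - 972 * X 0 ^ 7 * X 1 + 2700 * X 0 ^ 5 * X 1 ^ 2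
        - 3456 * X 0 ^ 3 * X 1 ^ 3), ?_⟩
  unfold R51 R61
  linear_combination (X 0 ^ 15 - 102 * X 0 ^ 11 + 317 * X 0 ^ 7 - 2048 * X 0 ^ 3) * h16
end

section
/- In ℚ[x,y,q], set σ₄ = y² − (3/2)x²y + (1/2)x⁴, σ'₄ = −y² + (7/8)x²y − (1/8)x⁴ − q, σ₇ = (1/18)y³x + q((13/36)xy − (17/36)x³), and σ₈ = (1/9)y⁴ + q((2/9)y² + (29/36)x²y − (27/36)x⁴) + q². Then the polynomial σ₇·x − σ₈ − q·σ₄ − q·σ'₄ belongs to the ideal of ℚ[x,y,q] generated by R₅(q) = x⁵ − 5x³y + 6xy² + 4qx and R₆(q) = 16y³ − 27x²y² + 9x⁴y + 32qy − 28qx². -/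
open MvPolynomial

/-- `σ₄ = y² − (3/2)x²y + (1/2)x⁴`. -/
noncomputable def s4 : MvPolynomial (Fin 3) ℚ :=
  X 1 ^ 2 - C (3 / 2 : ℚ) * X 0 ^ 2 * X 1 + C (1 / 2 : ℚ) * X 0 ^ 4

/-- `σ'₄ = −y² + (7/8)x²y − (1/8)x⁴ − q`. -/
noncomputable def s4' : MvPolynomial (Fin 3) ℚ :=
  -X 1 ^ 2 + C (7 / 8 : ℚ) * X 0 ^ 2 * X 1 - C (1 / 8 : ℚ) * X 0 ^ 4 - X 2

/-- `σ₇ = (1/18)y³x + q((13/36)xy − (17/36)x³)`. -/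
noncomputable def s7 : MvPolynomial (Fin 3) ℚ :=
  C (1 / 18 : ℚ) * X 1 ^ 3 * X 0 +
    X 2 * (C (13 / 36 : ℚ) * X 0 * X 1 - C (17 / 36 : ℚ) * X 0 ^ 3)

/-- `σ₈ = (1/9)y⁴ + q((2/9)y² + (29/36)x²y − (27/36)x⁴) + q²`. -/
noncomputable def s8 : MvPolynomial (Fin 3) ℚ :=
  C (1 / 9 : ℚ) * X 1 ^ 4 +
    X 2 * (C (2 / 9 : ℚ) * X 1 ^ 2 + C (29 / 36 : ℚ) * X 0 ^ 2 * X 1 -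
      C (27 / 36 : ℚ) * X 0 ^ 4) + X 2 ^ 2

/-- The quantum Chevalley relation `σ₇·σ₁ = σ₈ + qσ₄ + qσ'₄` holds modulo
`⟨R₅(q), R₆(q)⟩`. -/
theorem stmt_14 :
    s7 * X 0 - s8 - X 2 * s4 - X 2 * s4' ∈
      Ideal.span ({R5q, R6q} : Set (MvPolynomial (Fin 3) ℚ)) := by
  have hC (n : ℕ) (r : ℚ) (h : r = n * (1 / 288)) :
      C r = (n : MvPolynomial (Fin 3) ℚ) * C (1 / 288) := by
    rw [h, C_mul, map_natCast]
  refine Ideal.mem_span_pair.mpr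
    ⟨-(9 * C (1 / 288) * X 0 * X 1), C (1 / 288) * X 0 ^ 2 - 2 * C (1 / 288) * X 1, ?_⟩
  rw [R5q, R6q, s4, s4', s7, s8, hC 432 (3 / 2) (by norm_num), hC 144 (1 / 2) (by norm_num),
    hC 252 (7 / 8) (by norm_num), hC 36 (1 / 8) (by norm_num), hC 16 (1 / 18) (by norm_num),
    hC 104 (13 / 36) (by norm_num), hC 136 (17 / 36) (by norm_num), hC 32 (1 / 9) (by norm_num),
    hC 64 (2 / 9) (by norm_num), hC 232 (29 / 36) (by norm_num), hC 216 (27 / 36) (by norm_num)]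
  push_cast
  ring
end

section
/- In ℚ[x,y,q], set σ₅ = (1/2)x³y − xy² − (3/2)qx and σ₈ = (1/9)y⁴ + q((2/9)y² + (29/36)x²y − (27/36)x⁴) + q². Then the polynomial σ₈·x − 2q·σ₅ belongs to the ideal of ℚ[x,y,q] generated by R₅(q) = x⁵ − 5x³y + 6xy² + 4qx and R₆(q) = 16y³ − 27x²y² + 9x⁴y + 32qy − 28qx². -/
open MvPolynomial

/-- `σ₅ = (1/2)x³y − xy² − (3/2)qx`. -/
noncomputable def s5 : MvPolynomial (Fin 3) ℚ :=
  C (1 / 2 : ℚ) * X 0 ^ 3 * X 1 - X 0 * X 1 ^ 2 - C (3 / 2 : ℚ) * X 2 * X 0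

/-- The quantum Chevalley relation `σ₈·σ₁ = 2qσ₅` holds modulo `⟨R₅(q), R₆(q)⟩`. -/
theorem stmt_15 :
    s8 * X 0 - 2 * X 2 * s5 ∈
      Ideal.span ({R5q, R6q} : Set (MvPolynomial (Fin 3) ℚ)) := by
  refine Ideal.mem_span_pair.mpr
    ⟨C (-9 / 16) * X 0 ^ 2 * X 1 + C (1 / 2) * X 1 ^ 2 + X 2,
      C (1 / 16) * X 0 ^ 3 - C (13 / 72) * X 0 * X 1, ?_⟩
  refine MvPolynomial.funext fun v => ?_
  simp only [R5q, R6q, s5, s8, map_add, map_sub, map_mul, map_pow, map_ofNat, eval_X, eval_C]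
  ring
end
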